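/- arXiv:2310.01611 — 8 statements merged into one kernel-verified Lean document; each statement's English description precedes it below -/
import Mathlib

section
/- There exists an absolute constant c > 0 with the following property. Let p be an odd prime, let W be a real Hilbert space, w₀ ∈ W, and let f and g be as in the context. Suppose D ≥ 0 satisfies (1/(p−1)) · Σ_{x ∈ (ZMod p)ˣ} ‖g(x)‖² ≤ D². For each a ∈ (ZMod p)ˣ define the square-loss objective L_a : W → ℝ by L_a(w) = (1/(p−1)) · Σ_{x ∈ (ZMod p)ˣ} ½·(f(w)(x) − h_a(x))². Then, writing ∇L_a(w₀) for the gradient of L_a at w₀ and μ = (1/(p−1)) · Σ_{a ∈ (ZMod p)ˣ} ∇L_a(w₀), one has (1/(p−1)) · Σ_{a ∈ (ZMod p)ˣ} ‖∇L_a(w₀) − μ‖² ≤ c · D² · (ln p)/√p. -/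
open Finset in
lemma sum_range_inv_abs_sub_two_mul_le {p : ℕ} (hp : Odd p) :
    ∑ k ∈ range p, 1 / |(p : ℝ) - 2 * k| ≤ 2 * (1 + Real.log p) := by
  obtain ⟨q, rfl⟩ := hp
  have hterm (j : ℕ) : 1 / |2 * (j : ℝ) + 1| ≤ ((j : ℝ) + 1)⁻¹ := by
    rw [abs_of_nonneg (by positivity), one_div]
    gcongr
    linarith [(j.cast_nonneg : (0 : ℝ) ≤ j)]
  have hsum (n : ℕ) (hn : n ≤ 2 * q + 1) :
      ∑ j ∈ range n, 1 / |2 * (j : ℝ) + 1| ≤ 1 + Real.log ((2 * q + 1 : ℕ) : ℝ) := by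
    rcases Nat.eq_zero_or_pos n with rfl | hn0
    · simpa using add_nonneg zero_le_one (Real.log_natCast_nonneg (2 * q + 1))
    calc ∑ j ∈ range n, 1 / |2 * (j : ℝ) + 1| ≤ ∑ j ∈ range n, ((j : ℝ) + 1)⁻¹ :=
          sum_le_sum fun j _ => hterm j
      _ = (harmonic n : ℝ) := by simp [harmonic]
      _ ≤ 1 + Real.log n := harmonic_le_one_add_log n
      _ ≤ _ := by gcongr
  have hsplit : ∑ k ∈ range (2 * q + 1), 1 / |((2 * q + 1 : ℕ) : ℝ) - 2 * k| =
      ∑ j ∈ range (q + 1), 1 / |2 * (j : ℝ) + 1| + ∑ j ∈ range q, 1 / |2 * (j : ℝ) + 1| := by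
    rw [show 2 * q + 1 = (q + 1) + q by ring, sum_range_add]
    congr 1
    · rw [← sum_range_reflect]
      refine sum_congr rfl fun j hj => ?_
      have hj' : j ≤ q := by simpa [Nat.lt_succ_iff] using hj
      rw [show q + 1 - 1 - j = q - j by omega, Nat.cast_sub hj']
      push_cast
      ring_nf
    · refine sum_congr rfl fun j _ => ?_
      rw [← abs_neg]
      push_cast
      ring_nf
  rw [hsplit]
  linarith [hsum (q + 1) (by omega), hsum q (by omega)]

lemma ZMod.sum_eq_sum_range {p : ℕ} [NeZero p] {M : Type*} [AddCommMonoid M] (F : ℕ → M) :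
    ∑ z : ZMod p, F z.val = ∑ n ∈ Finset.range p, F n := by
  rw [← Fin.sum_univ_eq_sum_range]
  obtain ⟨n, rfl⟩ := Nat.exists_eq_succ_of_ne_zero (NeZero.ne p)
  rfl

/-- The Fourier coefficients of the parity function `z ↦ (-1) ^ z.val` on `ZMod p`. -/
noncomputable def parityCoeff (p : ℕ) [NeZero p] (k : ZMod p) : ℂ :=
  (p : ℂ)⁻¹ * ∑ y : ZMod p, (-1) ^ y.val * ZMod.stdAddChar (-(k * y))

lemma neg_one_pow_val_eq_sum {p : ℕ} [NeZero p] (z : ZMod p) :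
    ((-1) ^ z.val : ℂ) = ∑ k : ZMod p, parityCoeff p k * ZMod.stdAddChar (k * z) := by
  have hp : (p : ℂ) ≠ 0 := NeZero.ne _
  calc ((-1) ^ z.val : ℂ)
      = (p : ℂ)⁻¹ * ∑ y : ZMod p, (-1) ^ y.val *
          ∑ k : ZMod p, ZMod.stdAddChar (k * (z - y)) := by
        simp_rw [AddChar.sum_mulShift _ (ZMod.isPrimitive_stdAddChar p), sub_eq_zero]
        simp
        field_simp
    _ = _ := by
        simp_rw [parityCoeff, mul_assoc, ← Finset.mul_sum, Finset.sum_mul, Finset.mul_sum]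
        rw [Finset.sum_comm]
        refine Finset.sum_congr rfl fun k _ => Finset.sum_congr rfl fun y _ => ?_
        rw [mul_sub, sub_eq_add_neg, AddChar.map_add_eq_mul]
        ring

lemma norm_one_add_stdAddChar {p : ℕ} [NeZero p] (k : ZMod p) :
    |(p : ℝ) - 2 * k.val| / p * 2 ≤ ‖1 + ZMod.stdAddChar (-k)‖ := by
  have hp : (0 : ℝ) < p := Nat.cast_pos.2 (NeZero.pos p)
  have hkp : (k.val : ℝ) ≤ p := by exact_mod_cast (ZMod.val_lt k).le
  set θ : ℝ := Real.pi * ((p : ℝ) - 2 * k.val) / p with hθ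
  have hE : ZMod.stdAddChar (-k) = -Complex.exp (Complex.I * θ) := by
    have hk : (-k : ZMod p) = ((-(k.val : ℤ) : ℤ) : ZMod p) := by simp
    rw [hk, ZMod.stdAddChar_coe]
    rw [← neg_one_mul (Complex.exp (Complex.I * θ)), ← Complex.exp_neg_pi_mul_I,
      ← Complex.exp_add]
    congr 1
    rw [hθ]
    push_cast
    have : (p : ℂ) ≠ 0 := NeZero.ne _
    field_simp
    ring
  have habs : |θ / 2| = Real.pi / 2 * (|(p : ℝ) - 2 * k.val| / p) := by
    rw [hθ, abs_div, abs_div, abs_mul, abs_of_pos Real.pi_pos, abs_of_pos hp, abs_two]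
    ring
  have hle : |(p : ℝ) - 2 * k.val| ≤ p := by
    rw [abs_le]
    constructor <;> linarith [(k.val.cast_nonneg : (0 : ℝ) ≤ k.val)]
  have hsin := Real.mul_abs_le_abs_sin (x := θ / 2) (by
    rw [habs]
    exact mul_le_of_le_one_right (by positivity) ((div_le_one hp).2 hle))
  rw [hE, ← sub_eq_add_neg, norm_sub_rev, Complex.norm_exp_I_mul_ofReal_sub_one, norm_mul,
    Real.norm_eq_abs, Real.norm_eq_abs, abs_two, mul_comm]
  rw [habs] at hsin
  have : 2 / Real.pi * (Real.pi / 2 * (|(p : ℝ) - 2 * k.val| / p)) =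
      |(p : ℝ) - 2 * k.val| / p := by
    field_simp
  linarith

lemma norm_parityCoeff_le {p : ℕ} [NeZero p] (hp : Odd p) (k : ZMod p) :
    ‖parityCoeff p k‖ ≤ 1 / |(p : ℝ) - 2 * k.val| := by
  have hp0 : (0 : ℝ) < p := Nat.cast_pos.2 (NeZero.pos p)
  set ζ : ℂ := ZMod.stdAddChar (-k) with hζ
  have hpow : ζ ^ p = 1 := by
    rw [hζ, ← AddChar.map_nsmul_eq_pow]
    simp
  have hsum : ∑ y : ZMod p, (-1 : ℂ) ^ y.val * ZMod.stdAddChar (-(k * y)) =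
      ∑ n ∈ Finset.range p, (-ζ) ^ n := by
    rw [← ZMod.sum_eq_sum_range]
    refine Finset.sum_congr rfl fun y _ => ?_
    rw [neg_pow ζ, hζ, ← AddChar.map_nsmul_eq_pow]
    congr 2
    rw [nsmul_eq_mul, ZMod.natCast_zmod_val]
    ring
  have hgeom : (1 + ζ) * ∑ n ∈ Finset.range p, (-ζ) ^ n = 2 := by
    have := mul_neg_geom_sum (-ζ) p
    rw [hp.neg_pow, hpow] at this
    rw [← sub_neg_eq_add, this]
    norm_num
  have hodd : 0 < |(p : ℝ) - 2 * k.val| := by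
    rw [abs_pos, sub_ne_zero]
    intro h
    have h' : p = 2 * k.val := by exact_mod_cast h
    exact (Nat.not_even_iff_odd.2 hp) (h' ▸ even_two_mul _)
  have hnorm := congrArg norm hgeom
  rw [norm_mul, Complex.norm_ofNat] at hnorm
  rw [parityCoeff, hsum, norm_mul, norm_inv, Complex.norm_natCast, le_div_iff₀ hodd]
  have := mul_le_mul_of_nonneg_right (norm_one_add_stdAddChar k)
    (norm_nonneg (∑ n ∈ Finset.range p, (-ζ) ^ n))
  rw [hnorm] at this
  calc _ = (|(p : ℝ) - 2 * k.val| / p * 2 * ‖∑ n ∈ Finset.range p, (-ζ) ^ n‖) / 2 := by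
        field_simp
    _ ≤ 1 := by linarith

lemma sum_norm_parityCoeff_le {p : ℕ} [NeZero p] (hp : Odd p) :
    ∑ k : ZMod p, ‖parityCoeff p k‖ ≤ 2 * (1 + Real.log p) :=
  calc ∑ k : ZMod p, ‖parityCoeff p k‖ ≤ ∑ k : ZMod p, 1 / |(p : ℝ) - 2 * k.val| :=
        Finset.sum_le_sum fun k _ => norm_parityCoeff_le hp k
    _ = ∑ k ∈ Finset.range p, 1 / |(p : ℝ) - 2 * k| :=
        ZMod.sum_eq_sum_range fun n => 1 / |(p : ℝ) - 2 * n|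
    _ ≤ _ := sum_range_inv_abs_sub_two_mul_le hp

section Characters

variable {p : ℕ} [Fact p.Prime] {W : Type*} [NormedAddCommGroup W] [InnerProductSpace ℝ W]

/-- The squared norm of the exponential sum `∑ x, e(z x / p) g(x)`, computed in the
complexification of `W`. -/
noncomputable def expSumSq (g : (ZMod p)ˣ → W) (z : ZMod p) : ℝ :=
  ‖∑ x : (ZMod p)ˣ, (ZMod.stdAddChar (z * (x : ZMod p))).re • g x‖ ^ 2 +
    ‖∑ x : (ZMod p)ˣ, (ZMod.stdAddChar (z * (x : ZMod p))).im • g x‖ ^ 2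

lemma expSumSq_nonneg (g : (ZMod p)ˣ → W) (z : ZMod p) : 0 ≤ expSumSq g z := by
  unfold expSumSq
  positivity

lemma sum_expSumSq (g : (ZMod p)ˣ → W) :
    ∑ z : ZMod p, expSumSq g z = p * ∑ x, ‖g x‖ ^ 2 := by
  have hre (z : ZMod p) (x y : (ZMod p)ˣ) :
      (ZMod.stdAddChar (z * (x : ZMod p))).re * (ZMod.stdAddChar (z * (y : ZMod p))).re +
      (ZMod.stdAddChar (z * (x : ZMod p))).im * (ZMod.stdAddChar (z * (y : ZMod p))).im =
      (ZMod.stdAddChar (z * ((x : ZMod p) - (y : ZMod p)))).re := by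
    rw [mul_sub, sub_eq_add_neg, AddChar.map_add_eq_mul, AddChar.map_neg_eq_conj]
    simp
  have hexp (z : ZMod p) : expSumSq g z =
      ∑ x : (ZMod p)ˣ, ∑ y : (ZMod p)ˣ,
        (ZMod.stdAddChar (z * ((x : ZMod p) - (y : ZMod p)))).re * inner ℝ (g x) (g y) := by
    simp_rw [expSumSq, ← real_inner_self_eq_norm_sq, sum_inner, inner_sum, real_inner_smul_left,
      real_inner_smul_right, ← Finset.sum_add_distrib, ← hre]
    refine Finset.sum_congr rfl fun x _ => Finset.sum_congr rfl fun y _ => ?_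
    ring
  simp_rw [hexp]
  rw [Finset.sum_comm]
  simp_rw [Finset.sum_comm (s := (Finset.univ : Finset (ZMod p))), ← Finset.sum_mul,
    ← Complex.re_sum, AddChar.sum_mulShift _ (ZMod.isPrimitive_stdAddChar p), sub_eq_zero,
    Units.val_inj]
  rw [Finset.mul_sum]
  refine Finset.sum_congr rfl fun x _ => ?_
  rw [Finset.sum_eq_single x]
  · simp
  · intro y _ hy
    simp [hy.symm]
  · simp

lemma sum_expSumSq_mul_le (g : (ZMod p)ˣ → W) {k : ZMod p} (hk : k ≠ 0) :
    ∑ a : (ZMod p)ˣ, expSumSq g (k * ((a⁻¹ : (ZMod p)ˣ) : ZMod p)) ≤ p * ∑ x, ‖g x‖ ^ 2 := by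
  rw [← sum_expSumSq]
  have hinj : Function.Injective fun a : (ZMod p)ˣ => k * ((a⁻¹ : (ZMod p)ˣ) : ZMod p) :=
    fun a b h => inv_injective (Units.ext (mul_left_cancel₀ hk h))
  refine (Finset.sum_map Finset.univ ⟨_, hinj⟩ (expSumSq g)).symm.trans_le ?_
  exact Finset.sum_le_sum_of_subset_of_nonneg (Finset.subset_univ _)
    fun z _ _ => expSumSq_nonneg g z

lemma card_zmod_units : (Fintype.card (ZMod p)ˣ : ℝ) = (p : ℝ) - 1 := by
  rw [ZMod.card_units, Nat.cast_sub (Fact.out : p.Prime).one_lt.le, Nat.cast_one]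

lemma expSumSq_zero_le (g : (ZMod p)ˣ → W) :
    expSumSq g 0 ≤ ((p : ℝ) - 1) * ∑ x, ‖g x‖ ^ 2 := by
  have h : ‖∑ x, g x‖ ^ 2 ≤ (∑ x, ‖g x‖) ^ 2 := by
    gcongr
    exact norm_sum_le _ _
  have h' := sq_sum_le_card_mul_sum_sq (s := Finset.univ) (f := fun x => ‖g x‖)
  rw [Finset.card_univ, card_zmod_units] at h'
  simpa [expSumSq] using h.trans h'

lemma norm_sq_sum_parity_smul_le (g : (ZMod p)ˣ → W) (a : (ZMod p)ˣ) :
    ‖∑ x, ((-1 : ℝ) ^ (((a⁻¹ * x : (ZMod p)ˣ) : ZMod p)).val) • g x‖ ^ 2 ≤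
      (∑ k : ZMod p, ‖parityCoeff p k‖) *
        ∑ k : ZMod p, ‖parityCoeff p k‖ *
          expSumSq g (k * ((a⁻¹ : (ZMod p)ˣ) : ZMod p)) := by
  set E : ZMod p → (ZMod p)ˣ → ℂ := fun k x =>
    ZMod.stdAddChar (k * ((a⁻¹ : (ZMod p)ˣ) : ZMod p) * (x : ZMod p)) with hE
  set v : ZMod p → W := fun k =>
    (parityCoeff p k).re • (∑ x, (E k x).re • g x) -
      (parityCoeff p k).im • (∑ x, (E k x).im • g x) with hv
  have hexp : ∑ x, ((-1 : ℝ) ^ (((a⁻¹ * x : (ZMod p)ˣ) : ZMod p)).val) • g x = ∑ k, v k := by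
    have hx (x : (ZMod p)ˣ) : (-1 : ℝ) ^ (((a⁻¹ * x : (ZMod p)ˣ) : ZMod p)).val =
        ∑ k, ((parityCoeff p k).re * (E k x).re - (parityCoeff p k).im * (E k x).im) := by
      have := congrArg Complex.re (neg_one_pow_val_eq_sum ((a⁻¹ * x : (ZMod p)ˣ) : ZMod p))
      rw [Complex.re_sum] at this
      simp_rw [Complex.mul_re, Units.val_mul, ← mul_assoc] at this
      rw [Units.val_mul, ← this]
      norm_cast
    simp_rw [hx, hv, Finset.sum_smul, sub_smul, mul_smul, Finset.smul_sum,
      ← Finset.sum_sub_distrib]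
    exact Finset.sum_comm
  have hvk (k : ZMod p) : ‖v k‖ ^ 2 ≤ ‖parityCoeff p k‖ * (‖parityCoeff p k‖ *
      expSumSq g (k * ((a⁻¹ : (ZMod p)ˣ) : ZMod p))) := by
    have h1 := norm_sub_le ((parityCoeff p k).re • (∑ x, (E k x).re • g x))
      ((parityCoeff p k).im • (∑ x, (E k x).im • g x))
    rw [norm_smul, norm_smul, Real.norm_eq_abs, Real.norm_eq_abs] at h1
    have h2 : ‖v k‖ ^ 2 ≤ _ := pow_le_pow_left₀ (norm_nonneg _) h1 2
    refine h2.trans ?_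
    rw [← mul_assoc, ← sq, Complex.sq_norm, Complex.normSq_apply, expSumSq]
    simp only [hE]
    set c := ‖∑ x : (ZMod p)ˣ,
      (ZMod.stdAddChar (k * ((a⁻¹ : (ZMod p)ˣ) : ZMod p) * (x : ZMod p))).re • g x‖
    set s := ‖∑ x : (ZMod p)ˣ,
      (ZMod.stdAddChar (k * ((a⁻¹ : (ZMod p)ˣ) : ZMod p) * (x : ZMod p))).im • g x‖
    rw [← abs_mul_abs_self (parityCoeff p k).re, ← abs_mul_abs_self (parityCoeff p k).im]
    nlinarith [sq_nonneg (|(parityCoeff p k).re| * s - |(parityCoeff p k).im| * c)]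
  rw [hexp]
  calc ‖∑ k, v k‖ ^ 2 ≤ (∑ k, ‖v k‖) ^ 2 := by
        gcongr
        exact norm_sum_le _ _
    _ ≤ _ := Finset.sum_sq_le_sum_mul_sum_of_sq_le_mul _ (fun _ _ => norm_nonneg _)
        (fun k _ => mul_nonneg (norm_nonneg _) (expSumSq_nonneg _ _)) fun k _ => hvk k

lemma sum_norm_sq_sum_parity_smul_le (hp : Odd p) (g : (ZMod p)ˣ → W) :
    ∑ a : (ZMod p)ˣ, ‖∑ x, ((-1 : ℝ) ^ (((a⁻¹ * x : (ZMod p)ˣ) : ZMod p)).val) • g x‖ ^ 2 ≤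
      (∑ k : ZMod p, ‖parityCoeff p k‖) * (∑ k : ZMod p, ‖parityCoeff p k‖ + 1) *
        (p * ∑ x, ‖g x‖ ^ 2) := by
  have hp1 : (1 : ℝ) ≤ p := by exact_mod_cast (Fact.out : p.Prime).one_lt.le
  set G := ∑ x, ‖g x‖ ^ 2 with hG
  have hG0 : 0 ≤ G := by positivity
  have hterm (k : ZMod p) : ‖parityCoeff p k‖ *
      ∑ a : (ZMod p)ˣ, expSumSq g (k * ((a⁻¹ : (ZMod p)ˣ) : ZMod p)) ≤
      ‖parityCoeff p k‖ * (p * G) + if k = 0 then p * G else 0 := by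
    split_ifs with hk
    · subst hk
      have h0 : ‖parityCoeff p 0‖ ≤ 1 / p := by simpa using norm_parityCoeff_le hp 0
      have hsum : ∑ a : (ZMod p)ˣ, expSumSq g (0 * ((a⁻¹ : (ZMod p)ˣ) : ZMod p)) ≤
          p * (p * G) := by
        simp_rw [zero_mul, Finset.sum_const, Finset.card_univ, nsmul_eq_mul, card_zmod_units]
        have := expSumSq_zero_le g
        rw [← hG] at this
        exact mul_le_mul (by linarith) (this.trans (by gcongr; linarith)) (expSumSq_nonneg _ _)
          (by linarith)
      calc _ ≤ 1 / (p : ℝ) * (p * (p * G)) :=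
            mul_le_mul h0 hsum (Finset.sum_nonneg fun _ _ => expSumSq_nonneg _ _) (by positivity)
        _ = p * G := by field_simp
        _ ≤ _ := le_add_of_nonneg_left (by positivity)
    · rw [add_zero]
      gcongr
      exact sum_expSumSq_mul_le g hk
  calc _ ≤ ∑ a : (ZMod p)ˣ, (∑ k : ZMod p, ‖parityCoeff p k‖) *
        ∑ k : ZMod p, ‖parityCoeff p k‖ * expSumSq g (k * ((a⁻¹ : (ZMod p)ˣ) : ZMod p)) :=
        Finset.sum_le_sum fun a _ => norm_sq_sum_parity_smul_le g a
    _ = (∑ k : ZMod p, ‖parityCoeff p k‖) * ∑ k : ZMod p, ‖parityCoeff p k‖ *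
        ∑ a : (ZMod p)ˣ, expSumSq g (k * ((a⁻¹ : (ZMod p)ˣ) : ZMod p)) := by
        rw [← Finset.mul_sum, Finset.sum_comm]
        simp_rw [Finset.mul_sum]
    _ ≤ (∑ k : ZMod p, ‖parityCoeff p k‖) *
        ∑ k : ZMod p, (‖parityCoeff p k‖ * (p * G) + if k = 0 then p * G else 0) := by
        gcongr with k _
        exact hterm k
    _ = _ := by
        rw [Finset.sum_add_distrib, ← Finset.sum_mul, Finset.sum_ite_eq' Finset.univ 0]
        simp only [Finset.mem_univ, if_true]
        ring

lemma sum_parity_inv_mul_eq_zero (hp : Odd p) (x : (ZMod p)ˣ) :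
    ∑ b : (ZMod p)ˣ, (-1 : ℝ) ^ (((b⁻¹ * x : (ZMod p)ˣ) : ZMod p)).val = 0 := by
  have hneg (u : (ZMod p)ˣ) :
      (-1 : ℝ) ^ (((-u : (ZMod p)ˣ) : ZMod p)).val = -(-1 : ℝ) ^ (u : ZMod p).val := by
    have hlt := ZMod.val_lt (u : ZMod p)
    rw [Units.val_neg, ZMod.neg_val, if_neg u.ne_zero]
    rcases Nat.even_or_odd (u : ZMod p).val with h | h
    · rw [h.neg_one_pow, (Nat.Odd.sub_even hlt.le hp h).neg_one_pow]
    · rw [h.neg_one_pow, (Nat.Odd.sub_odd hp h).neg_one_pow, neg_neg]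
  have h := Equiv.sum_comp (Equiv.neg (ZMod p)ˣ)
    fun b => (-1 : ℝ) ^ (((b⁻¹ * x : (ZMod p)ˣ) : ZMod p)).val
  simp only [Equiv.neg_apply, inv_neg, neg_mul, hneg, Finset.sum_neg_distrib] at h
  linarith

end Characters

lemma gradient_const_mul_sum_half_sq_sub {ι W : Type*} [Fintype ι] [NormedAddCommGroup W]
    [InnerProductSpace ℝ W] [CompleteSpace W] {w₀ : W} {f : W → ι → ℝ}
    (hf : ∀ x, DifferentiableAt ℝ (fun w => f w x) w₀) (c : ℝ) (h : ι → ℝ) :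
    gradient (fun w => c * ∑ x, (1 / 2) * (f w x - h x) ^ 2) w₀ =
      c • ∑ x, (f w₀ x - h x) • gradient (fun w => f w x) w₀ := by
  have hd : HasFDerivAt (fun w => c * ∑ x, (1 / 2) * (f w x - h x) ^ 2)
      (c • ∑ x, (f w₀ x - h x) • fderiv ℝ (fun w => f w x) w₀) w₀ := by
    refine HasFDerivAt.const_mul (HasFDerivAt.fun_sum fun x _ => ?_) c
    refine ((((hf x).hasFDerivAt.sub_const (h x)).pow 2).const_mul (1 / 2)).congr_fderiv ?_
    ext v
    simp
    ring
  rw [gradient, hd.fderiv]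
  simp [gradient]


/-- There is an absolute constant `c > 0` with the following property. Let `p` be an odd
prime, `W` a real Hilbert space, `w₀ ∈ W`, and `f : W → (ZMod p)ˣ → ℝ` with each
`w ↦ f(w)(x)` differentiable at `w₀`, with gradient `g(x)` there. If
`(1/(p-1)) · Σ_x ‖g(x)‖² ≤ D²`, then for the square-loss objectives
`L_a(w) = (1/(p-1)) · Σ_x ½·(f(w)(x) − h_a(x))²` (with
`h_a(x) = (-1)^((a⁻¹·x).val)` the parity bit of the discrete logarithm of `x` to base `a`
in `(ZMod p, +)`), the variance of the gradient satisfies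
`(1/(p-1)) · Σ_a ‖∇L_a(w₀) − μ‖² ≤ c · D² · ln p / √p`, where
`μ = (1/(p-1)) · Σ_a ∇L_a(w₀)`. -/
theorem gradient_concentration_square_loss :
    ∃ c : ℝ, 0 < c ∧
      ∀ (p : ℕ) [Fact (Nat.Prime p)], Odd p →
        ∀ (W : Type) [NormedAddCommGroup W] [InnerProductSpace ℝ W] [CompleteSpace W]
          (w₀ : W) (f : W → (ZMod p)ˣ → ℝ),
          (∀ x : (ZMod p)ˣ, DifferentiableAt ℝ (fun w => f w x) w₀) →
          ∀ D : ℝ, 0 ≤ D →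
            (1 / ((p : ℝ) - 1)) *
                ∑ x : (ZMod p)ˣ, ‖gradient (fun w => f w x) w₀‖ ^ 2 ≤ D ^ 2 →
            (1 / ((p : ℝ) - 1)) *
                ∑ a : (ZMod p)ˣ,
                  ‖gradient
                        (fun w =>
                          (1 / ((p : ℝ) - 1)) *
                            ∑ x : (ZMod p)ˣ,
                              (1 / 2) *
                                (f w x -
                                    (-1 : ℝ) ^
                                      (((a⁻¹ * x : (ZMod p)ˣ) : ZMod p)).val) ^ 2)
                        w₀ -
                      (1 / ((p : ℝ) - 1)) •
                        ∑ b : (ZMod p)ˣ,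
                          gradient
                            (fun w =>
                              (1 / ((p : ℝ) - 1)) *
                                ∑ x : (ZMod p)ˣ,
                                  (1 / 2) *
                                    (f w x -
                                        (-1 : ℝ) ^
                                          (((b⁻¹ * x : (ZMod p)ˣ) : ZMod p)).val) ^ 2)
                            w₀‖ ^ 2 ≤
              c * D ^ 2 * Real.log p / Real.sqrt p := by
  refine ⟨90, by norm_num, ?_⟩
  intro p _ hp W _ _ _ w₀ f hf D hD hg
  have hp3 : (3 : ℝ) ≤ p := by
    have h2 := (Fact.out : p.Prime).two_le
    have : 3 ≤ p := by
      obtain ⟨q, rfl⟩ := hp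
      omega
    exact_mod_cast this
  set g : (ZMod p)ˣ → W := fun x => gradient (fun w => f w x) w₀
  set h : (ZMod p)ˣ → (ZMod p)ˣ → ℝ :=
    fun a x => (-1 : ℝ) ^ (((a⁻¹ * x : (ZMod p)ˣ) : ZMod p)).val
  have hgrad (a : (ZMod p)ˣ) := gradient_const_mul_sum_half_sq_sub hf (1 / ((p : ℝ) - 1)) (h a)
  have hpos : (0 : ℝ) < p - 1 := by linarith
  have hmean : (1 / ((p : ℝ) - 1)) • ∑ b : (ZMod p)ˣ,
      (1 / ((p : ℝ) - 1)) • ∑ x, (f w₀ x - h b x) • g x =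
      (1 / ((p : ℝ) - 1)) • ∑ x, f w₀ x • g x := by
    rw [← Finset.smul_sum, Finset.sum_comm]
    simp_rw [← Finset.sum_smul, Finset.sum_sub_distrib, h, sum_parity_inv_mul_eq_zero hp,
      Finset.sum_const, Finset.card_univ, sub_zero, nsmul_eq_mul, card_zmod_units, mul_smul,
      ← Finset.smul_sum]
    rw [smul_smul (1 / ((p : ℝ) - 1)) ((p : ℝ) - 1), one_div_mul_cancel hpos.ne', one_smul]
  have hdiff (a : (ZMod p)ˣ) :
      ‖(1 / ((p : ℝ) - 1)) • ∑ x, (f w₀ x - h a x) • g x -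
        (1 / ((p : ℝ) - 1)) • ∑ x, f w₀ x • g x‖ ^ 2 =
      (1 / ((p : ℝ) - 1)) ^ 2 * ‖∑ x, h a x • g x‖ ^ 2 := by
    simp_rw [sub_smul, Finset.sum_sub_distrib]
    rw [← smul_sub, sub_sub_cancel_left, norm_smul, norm_neg, mul_pow, Real.norm_eq_abs, sq_abs]
  change (1 / ((p : ℝ) - 1)) * ∑ a : (ZMod p)ˣ,
    ‖gradient (fun w => (1 / ((p : ℝ) - 1)) * ∑ x, (1 / 2) * (f w x - h a x) ^ 2) w₀ -
      (1 / ((p : ℝ) - 1)) • ∑ b : (ZMod p)ˣ,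
        gradient (fun w => (1 / ((p : ℝ) - 1)) * ∑ x, (1 / 2) * (f w x - h b x) ^ 2) w₀‖ ^ 2 ≤ _
  simp_rw [hgrad]
  change (1 / ((p : ℝ) - 1)) * ∑ a : (ZMod p)ˣ,
    ‖(1 / ((p : ℝ) - 1)) • ∑ x, (f w₀ x - h a x) • g x -
      (1 / ((p : ℝ) - 1)) • ∑ b : (ZMod p)ˣ,
        (1 / ((p : ℝ) - 1)) • ∑ x, (f w₀ x - h b x) • g x‖ ^ 2 ≤ _
  simp_rw [hmean, hdiff, ← Finset.mul_sum]
  have hlog : 1 ≤ Real.log p := by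
    rw [Real.le_log_iff_exp_le (by linarith)]
    linarith [Real.exp_one_lt_three]
  have hL := sum_norm_parityCoeff_le hp
  have hL0 : 0 ≤ ∑ k : ZMod p, ‖parityCoeff p k‖ := by positivity
  have hmain := sum_norm_sq_sum_parity_smul_le hp g
  set L := ∑ k : ZMod p, ‖parityCoeff p k‖
  set l := Real.log p
  have hLL : L * (L + 1) ≤ 20 * l ^ 2 := by nlinarith
  have hG : ∑ x, ‖g x‖ ^ 2 ≤ ((p : ℝ) - 1) * D ^ 2 := by
    rwa [one_div, inv_mul_le_iff₀ hpos] at hg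
  have hV : ∑ a : (ZMod p)ˣ, ‖∑ x, h a x • g x‖ ^ 2 ≤
      20 * l ^ 2 * (p * (((p : ℝ) - 1) * D ^ 2)) :=
    hmain.trans (by gcongr)
  set s := Real.sqrt p with hs
  have hs0 : 0 < s := Real.sqrt_pos.2 (by linarith)
  have hsp : s ^ 2 = p := Real.sq_sqrt (by linarith)
  have hls : l ≤ 2 * s := by
    have h1 : l = 2 * Real.log s := by
      rw [hs, Real.log_sqrt (by linarith)]
      ring
    linarith [Real.log_le_sub_one_of_pos hs0]
  calc _ ≤ (1 / ((p : ℝ) - 1)) * ((1 / ((p : ℝ) - 1)) ^ 2 *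
        (20 * l ^ 2 * (p * (((p : ℝ) - 1) * D ^ 2)))) := by gcongr
    _ = 20 * l ^ 2 * D ^ 2 * (p / ((p : ℝ) - 1) ^ 2) := by field_simp
    _ ≤ 20 * l ^ 2 * D ^ 2 * (9 / 4 / p) := by
        refine mul_le_mul_of_nonneg_left ?_ (by positivity)
        rw [div_le_div_iff₀ (by positivity) (by linarith)]
        nlinarith
    _ = 45 * D ^ 2 * l * l / s ^ 2 := by
        rw [hsp]
        ring
    _ ≤ 45 * D ^ 2 * l * (2 * s) / s ^ 2 := by gcongr
    _ = 90 * D ^ 2 * l / s := by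
        field_simp
        ring
end

section
/- There exists an absolute constant c > 0 such that for every odd prime p, (1/(p−1)) · Σ_{y ∈ (ZMod p)ˣ} f(y)² ≤ c · (ln p)² / p; that is, the variance of f over the nonzero elements of ZMod p (which has mean zero) is at most c·(ln p)²/p. -/
open Finset

/-- The function `z ↦ (-1)^z.val` on `ZMod p`, with complex values. -/
noncomputable def alternatingSign (p : ℕ) (z : ZMod p) : ℂ := (-1) ^ z.val

theorem ZMod.sum_val_eq_sum_range {M : Type*} [AddCommMonoid M] (n : ℕ) [NeZero n] (g : ℕ → M) :
    ∑ j : ZMod n, g j.val = ∑ i ∈ range n, g i :=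
  sum_nbij' (fun j => j.val) (fun i => (i : ZMod n))
    (fun j _ => mem_range.2 j.val_lt) (fun _ _ => mem_univ _)
    (fun j _ => ZMod.natCast_zmod_val j)
    (fun _ hi => ZMod.val_cast_of_lt (mem_range.1 hi)) (fun _ _ => rfl)

theorem dft_alternatingSign_mul {p : ℕ} [NeZero p] (hp : Odd p) (k : ZMod p) :
    ZMod.dft (alternatingSign p) k * (1 + ZMod.stdAddChar (-k)) = 2 := by
  set z : ℂ := ZMod.stdAddChar (-k) with hz
  have hzp : z ^ p = 1 := by
    rw [hz, ← AddChar.map_nsmul_eq_pow]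
    simp
  have hsum : ZMod.dft (alternatingSign p) k = ∑ i ∈ range p, (-z) ^ i := by
    rw [ZMod.dft_apply, ← ZMod.sum_val_eq_sum_range p fun i => (-z) ^ i]
    refine sum_congr rfl fun j _ => ?_
    have h : -(j * k) = j.val • (-k) := by simp
    rw [h, AddChar.map_nsmul_eq_pow, ← hz, alternatingSign, smul_eq_mul, neg_pow z, mul_comm]
  have hgeom := geom_sum_mul (-z) p
  rw [hp.neg_pow, hzp] at hgeom
  rw [hsum]
  linear_combination -hgeom

theorem abs_two_mul_sub_div_le_norm_one_add_stdAddChar {p : ℕ} [NeZero p] (k : ZMod p) :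
    2 * (|2 * (k.val : ℝ) - p| / p) ≤ ‖1 + ZMod.stdAddChar k‖ := by
  have hp : (0 : ℝ) < p := by exact_mod_cast Nat.pos_of_ne_zero (NeZero.ne p)
  have hk : (k.val : ℝ) ≤ p := by exact_mod_cast k.val_lt.le
  set t : ℝ := Real.pi * (2 * k.val - p) / p with ht
  have hexp : (ZMod.stdAddChar k : ℂ) = -Complex.exp (Complex.I * t) := by
    have h : ((k.val : ℤ) : ZMod p) = k := by simp
    rw [← h, ZMod.stdAddChar_coe, ← Complex.exp_add_pi_mul_I]
    congr 1
    rw [ht]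
    have : (p : ℂ) ≠ 0 := by exact_mod_cast hp.ne'
    push_cast
    field_simp
    ring
  have hnorm : ‖1 + (ZMod.stdAddChar k : ℂ)‖ = ‖2 * Real.sin (t / 2)‖ := by
    rw [← Complex.norm_exp_I_mul_ofReal_sub_one, hexp, ← norm_neg]
    congr 1
    ring
  have habs : |t / 2| = Real.pi / 2 * (|2 * (k.val : ℝ) - p| / p) := by
    rw [ht, abs_div, abs_div, abs_mul, abs_of_pos Real.pi_pos, abs_of_pos hp, abs_two]
    ring
  have hle : |2 * (k.val : ℝ) - p| / p ≤ 1 := by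
    rw [div_le_one hp, abs_le]
    constructor <;> linarith [(Nat.cast_nonneg k.val : (0 : ℝ) ≤ k.val)]
  have hsin := Real.mul_abs_le_abs_sin (x := t / 2)
    (by rw [habs]; nlinarith [Real.pi_pos])
  have hcancel : 2 / Real.pi * |t / 2| = |2 * (k.val : ℝ) - p| / p := by
    rw [habs]
    field_simp
  rw [hcancel] at hsin
  rw [hnorm, Real.norm_eq_abs, abs_mul, abs_two]
  linarith

theorem sum_range_inv_succ_le (n : ℕ) :
    ∑ i ∈ range n, ((i : ℝ) + 1)⁻¹ ≤ 1 + Real.log n := by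
  have h := harmonic_le_one_add_log n
  rw [harmonic] at h
  push_cast at h
  exact h

theorem sum_range_inv_abs_two_mul_sub_le {p : ℕ} (hp : Odd p) :
    ∑ k ∈ range p, |2 * (k : ℝ) - p|⁻¹ ≤ 2 * (1 + Real.log p) := by
  have hlog : ∀ m : ℕ, m ≤ p → ∑ i ∈ range m, ((i : ℝ) + 1)⁻¹ ≤ 1 + Real.log p := fun m hm =>
    (sum_le_sum_of_subset_of_nonneg (range_mono hm) fun _ _ _ => by positivity).trans
      (sum_range_inv_succ_le p)
  obtain ⟨n, hn⟩ := hp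
  have hpn : (p : ℝ) = 2 * n + 1 := by rw [hn]; push_cast; ring
  have hsplit : p = (n + 1) + n := by omega
  have hleft : ∑ k ∈ range (n + 1), |2 * (k : ℝ) - p|⁻¹ ≤ 1 + Real.log p := by
    rw [← sum_range_reflect]
    refine le_trans (sum_le_sum fun i hi => ?_) (hlog (n + 1) (by omega))
    have hi' : i ≤ n := by simpa [Nat.lt_succ_iff] using hi
    have hcast : ((n + 1 - 1 - i : ℕ) : ℝ) = n - i := by
      rw [Nat.add_sub_cancel, Nat.cast_sub hi']
    rw [hcast, hpn]
    apply inv_anti₀ (by positivity)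
    rw [abs_sub_comm]
    exact le_trans (by linarith [(Nat.cast_nonneg i : (0 : ℝ) ≤ i)]) (le_abs_self _)
  have hright : ∑ i ∈ range n, |2 * ((n + 1 + i : ℕ) : ℝ) - p|⁻¹ ≤ 1 + Real.log p := by
    refine le_trans (sum_le_sum fun i _ => ?_) (hlog n (by omega))
    rw [hpn]
    apply inv_anti₀ (by positivity)
    refine le_trans ?_ (le_abs_self _)
    push_cast
    linarith [(Nat.cast_nonneg i : (0 : ℝ) ≤ i)]
  have hrange : range p = range ((n + 1) + n) := by rw [← hsplit]
  rw [hrange, sum_range_add]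
  linarith

theorem sum_norm_dft_alternatingSign_le {p : ℕ} [NeZero p] (hp : Odd p) :
    ∑ k : ZMod p, ‖ZMod.dft (alternatingSign p) k‖ ≤ p * (2 * (1 + Real.log p)) := by
  have hp0 : (0 : ℝ) < p := by exact_mod_cast Nat.pos_of_ne_zero (NeZero.ne p)
  rw [← Equiv.sum_comp (Equiv.neg (ZMod p))]
  have hbound : ∀ k : ZMod p, ‖ZMod.dft (alternatingSign p) (-k)‖ ≤
      p * |2 * (k.val : ℝ) - p|⁻¹ := by
    intro k
    have hmul := congrArg norm (dft_alternatingSign_mul hp (-k))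
    rw [norm_mul, neg_neg, Complex.norm_ofNat] at hmul
    have hlow := abs_two_mul_sub_div_le_norm_one_add_stdAddChar k
    have hpos : 0 < |2 * (k.val : ℝ) - p| := by
      rw [abs_pos, sub_ne_zero]
      intro h
      have h' : 2 * k.val = p := by exact_mod_cast h
      obtain ⟨n, hn⟩ := hp
      omega
    rw [← div_eq_mul_inv, le_div_iff₀ hpos]
    have h := mul_le_mul_of_nonneg_left hlow
      (norm_nonneg (ZMod.dft (alternatingSign p) (-k)))
    rw [hmul] at h
    have h' : ‖ZMod.dft (alternatingSign p) (-k)‖ * (|2 * (k.val : ℝ) - p| / p) ≤ 1 := by linarith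
    rw [← mul_div_assoc, div_le_one hp0] at h'
    exact h'
  calc ∑ k : ZMod p, ‖ZMod.dft (alternatingSign p) (-k)‖
      ≤ ∑ k : ZMod p, p * |2 * (k.val : ℝ) - p|⁻¹ := sum_le_sum fun k _ => hbound k
    _ = p * ∑ k ∈ range p, |2 * (k : ℝ) - p|⁻¹ := by
        rw [← mul_sum, ← ZMod.sum_val_eq_sum_range p fun i => |2 * (i : ℝ) - p|⁻¹]
    _ ≤ _ := by gcongr; exact sum_range_inv_abs_two_mul_sub_le hp

/-- Parseval's identity for the correlation of `Φ` with a dilate of `Ψ`. -/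
theorem ZMod.sum_mul_dilate_eq_dft {n : ℕ} [NeZero n] (Φ Ψ : ZMod n → ℂ) (y : ZMod n) :
    ∑ x, Φ x * Ψ (y * x) = (n : ℂ)⁻¹ * ∑ k, ZMod.dft Ψ k * ZMod.dft Φ (-(k * y)) := by
  have hinv : ∀ z, Ψ z = (n : ℂ)⁻¹ * ∑ k, ZMod.stdAddChar (k * z) * ZMod.dft Ψ k := by
    intro z
    conv_lhs => rw [← ZMod.dft.symm_apply_apply Ψ]
    rw [ZMod.invDFT_apply]
    simp only [smul_eq_mul]
  calc ∑ x, Φ x * Ψ (y * x)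
      = ∑ x, ∑ k, (n : ℂ)⁻¹ * (ZMod.dft Ψ k * (ZMod.stdAddChar (-(x * -(k * y))) * Φ x)) := by
        refine sum_congr rfl fun x _ => ?_
        rw [hinv (y * x), mul_sum, mul_sum]
        refine sum_congr rfl fun k _ => ?_
        have h : -(x * -(k * y)) = k * (y * x) := by ring
        rw [h]
        ring
    _ = _ := by
        rw [sum_comm, mul_sum]
        refine sum_congr rfl fun k _ => ?_
        rw [ZMod.dft_apply Φ]
        simp only [smul_eq_mul, mul_sum]

theorem sum_units_comp_mul_le {p : ℕ} [Fact p.Prime] (g : ZMod p → ℝ) (hg : ∀ z, 0 ≤ g z)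
    {a : ZMod p} (ha : a ≠ 0) : ∑ y : (ZMod p)ˣ, g (a * y) ≤ ∑ z, g z := by
  have hinj : Function.Injective fun y : (ZMod p)ˣ => a * (y : ZMod p) :=
    (mul_right_injective₀ ha).comp Units.val_injective
  calc ∑ y : (ZMod p)ˣ, g (a * y)
      = ∑ z ∈ univ.map ⟨_, hinj⟩, g z := by rw [sum_map]; rfl
    _ ≤ ∑ z, g z := sum_le_sum_of_subset_of_nonneg (subset_univ _) fun z _ _ => hg z

theorem sum_norm_correlation_le {p : ℕ} [Fact p.Prime] (hp : Odd p) :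
    ∑ y : (ZMod p)ˣ, ‖∑ x, alternatingSign p x * alternatingSign p (y * x)‖ ≤
      1 + p * (2 * (1 + Real.log p)) ^ 2 := by
  have hp0 : (0 : ℝ) < p := by exact_mod_cast (Fact.out : p.Prime).pos
  set F := ZMod.dft (alternatingSign p) with hF
  have hF0 : ‖F 0‖ = 1 := by
    have h := congrArg norm (dft_alternatingSign_mul hp 0)
    rw [norm_mul, neg_zero, AddChar.map_zero_eq_one, one_add_one_eq_two, Complex.norm_ofNat] at h
    linarith
  have hcard : (Fintype.card (ZMod p)ˣ : ℝ) ≤ p := by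
    rw [ZMod.card_units]
    exact_mod_cast Nat.sub_le p 1
  set A := ∑ k, ‖F k‖ with hA
  have hA0 : 0 ≤ A := sum_nonneg fun _ _ => norm_nonneg _
  have hAle : A ≤ p * (2 * (1 + Real.log p)) := sum_norm_dft_alternatingSign_le hp
  have hinner : ∀ k : ZMod p, ∑ y : (ZMod p)ˣ, ‖F k‖ * ‖F (-(k * y))‖ ≤
      ‖F k‖ * A + if k = 0 then (p : ℝ) else 0 := by
    intro k
    rw [← mul_sum]
    by_cases hk : k = 0
    · subst hk
      simp only [zero_mul, neg_zero, hF0, sum_const, card_univ, if_true, nsmul_eq_mul]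
      linarith
    · rw [if_neg hk, add_zero]
      have h := sum_units_comp_mul_le (fun z => ‖F z‖) (fun z => norm_nonneg _) (neg_ne_zero.2 hk)
      simp only [neg_mul] at h
      gcongr
  calc ∑ y : (ZMod p)ˣ, ‖∑ x, alternatingSign p x * alternatingSign p (y * x)‖
      ≤ ∑ y : (ZMod p)ˣ, (p : ℝ)⁻¹ * ∑ k, ‖F k‖ * ‖F (-(k * y))‖ := by
        refine sum_le_sum fun y _ => ?_
        rw [ZMod.sum_mul_dilate_eq_dft, norm_mul, norm_inv, Complex.norm_natCast]
        gcongr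
        refine (norm_sum_le _ _).trans_eq (sum_congr rfl fun k _ => norm_mul _ _)
    _ = (p : ℝ)⁻¹ * ∑ k, ∑ y : (ZMod p)ˣ, ‖F k‖ * ‖F (-(k * y))‖ := by
        rw [← mul_sum, sum_comm]
    _ ≤ (p : ℝ)⁻¹ * ∑ k, (‖F k‖ * A + if k = 0 then (p : ℝ) else 0) := by
        exact mul_le_mul_of_nonneg_left (sum_le_sum fun k _ => hinner k) (by positivity)
    _ = (p : ℝ)⁻¹ * (A ^ 2 + p) := by
        rw [sum_add_distrib, ← sum_mul, sum_ite_eq' univ (0 : ZMod p), if_pos (mem_univ _), sq]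
    _ ≤ (p : ℝ)⁻¹ * ((p * (2 * (1 + Real.log p))) ^ 2 + p) :=
        mul_le_mul_of_nonneg_left (add_le_add_left (pow_le_pow_left₀ hA0 hAle 2) _)
          (by positivity)
    _ = 1 + p * (2 * (1 + Real.log p)) ^ 2 := by
        field_simp
        ring

theorem sum_units_eq_sum_sub {K M : Type*} [Field K] [Fintype K] [DecidableEq K]
    [AddCommGroup M] (g : K → M) : ∑ x : Kˣ, g x = ∑ x, g x - g 0 := by
  rw [eq_sub_iff_add_eq, ← Fintype.sum_subtype_add_sum_subtype (fun x : K => x ≠ 0) g]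
  congr 1
  · exact Fintype.sum_equiv unitsEquivNeZero _ _ fun _ => rfl
  · symm
    refine Fintype.sum_eq_single (⟨0, by simp⟩ : {x : K // ¬x ≠ 0}) fun x hx => ?_
    exact absurd (Subtype.ext (not_not.1 x.2)) hx

theorem abs_sum_units_sign_le {p : ℕ} [Fact p.Prime] (y : ZMod p) :
    |∑ x : (ZMod p)ˣ, (-1 : ℝ) ^ (x : ZMod p).val * (-1 : ℝ) ^ (y * (x : ZMod p)).val| ≤
      ‖∑ x, alternatingSign p x * alternatingSign p (y * x)‖ + 1 := by
  rw [sum_units_eq_sum_sub fun x : ZMod p => (-1 : ℝ) ^ x.val * (-1 : ℝ) ^ (y * x).val]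
  refine (abs_sub _ _).trans (add_le_add (le_of_eq ?_) (by simp))
  rw [← Real.norm_eq_abs, ← Complex.norm_real]
  simp [alternatingSign]

/-- There is an absolute constant `c > 0` such that for every odd prime `p`, the
variance (= second moment, the mean being zero) of
`f(y) = (1/(p-1)) · Σ_{x ∈ (ZMod p)ˣ} ε(x)·ε(y·x)` over `y ∈ (ZMod p)ˣ` is at most
`c · (ln p)² / p`, where `ε(z) = (-1)^z.val`. -/
theorem variance_f_le :
    ∃ c : ℝ, 0 < c ∧
      ∀ (p : ℕ) [Fact (Nat.Prime p)], Odd p →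
        (1 / ((p : ℝ) - 1)) *
            ∑ y : (ZMod p)ˣ,
              ((1 / ((p : ℝ) - 1)) *
                  ∑ x : (ZMod p)ˣ,
                    (-1 : ℝ) ^ (x : ZMod p).val *
                      (-1 : ℝ) ^ ((y : ZMod p) * (x : ZMod p)).val) ^ 2 ≤
          c * (Real.log p) ^ 2 / p := by
  refine ⟨72, by norm_num, fun p _ hp => ?_⟩
  have hprime : p.Prime := Fact.out
  have hp3 : 3 ≤ p := by
    have := hprime.two_le
    obtain ⟨n, hn⟩ := hp
    omega
  have hp3' : (3 : ℝ) ≤ p := by exact_mod_cast hp3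
  have hlog : 1 ≤ Real.log p := by
    rw [Real.le_log_iff_exp_le (by linarith)]
    linarith [Real.exp_one_lt_d9]
  have hcard : (Fintype.card (ZMod p)ˣ : ℝ) = p - 1 := by
    rw [ZMod.card_units, Nat.cast_sub hprime.one_le, Nat.cast_one]
  set S : (ZMod p)ˣ → ℝ := fun y => ∑ x : (ZMod p)ˣ,
    (-1 : ℝ) ^ (x : ZMod p).val * (-1 : ℝ) ^ ((y : ZMod p) * (x : ZMod p)).val with hS
  have hq : (0 : ℝ) < p - 1 := by linarith
  have htriv : ∀ y, |S y| ≤ p - 1 := by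
    intro y
    refine (abs_sum_le_sum_abs _ _).trans_eq ?_
    simp [abs_mul, ← hcard]
  have hsum : ∑ y, |S y| ≤ 18 * p * Real.log p ^ 2 := by
    have h : ∑ y, |S y| ≤ (1 + p * (2 * (1 + Real.log p)) ^ 2) + (p - 1) := by
      refine (sum_le_sum fun (y : (ZMod p)ˣ) _ => abs_sum_units_sign_le (y : ZMod p)).trans ?_
      rw [sum_add_distrib, sum_const, card_univ, nsmul_eq_mul, mul_one, hcard]
      gcongr
      exact sum_norm_correlation_le hp
    have hsq : (2 * (1 + Real.log p)) ^ 2 ≤ 16 * Real.log p ^ 2 := by nlinarith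
    have h1 : 1 ≤ Real.log p ^ 2 := by nlinarith
    nlinarith
  have hterm : ∀ y, (1 / ((p : ℝ) - 1) * S y) ^ 2 ≤ 1 / ((p : ℝ) - 1) * |S y| := by
    intro y
    have h : S y ^ 2 ≤ (p - 1) * |S y| := by
      rw [← sq_abs, sq]
      exact mul_le_mul_of_nonneg_right (htriv y) (abs_nonneg _)
    calc (1 / ((p : ℝ) - 1) * S y) ^ 2 = (1 / ((p : ℝ) - 1)) ^ 2 * S y ^ 2 := by ring
      _ ≤ (1 / ((p : ℝ) - 1)) ^ 2 * ((p - 1) * |S y|) := by gcongr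
      _ = 1 / ((p : ℝ) - 1) * |S y| := by field_simp
  calc 1 / ((p : ℝ) - 1) * ∑ y, (1 / ((p : ℝ) - 1) * S y) ^ 2
      ≤ 1 / ((p : ℝ) - 1) * (1 / ((p : ℝ) - 1) * (18 * p * Real.log p ^ 2)) := by
        refine mul_le_mul_of_nonneg_left ?_ (by positivity)
        refine (sum_le_sum fun y _ => hterm y).trans ?_
        rw [← mul_sum]
        exact mul_le_mul_of_nonneg_left hsum (by positivity)
    _ = 18 * p * Real.log p ^ 2 / ((p : ℝ) - 1) ^ 2 := by field_simp
    _ ≤ 72 * Real.log p ^ 2 / p := by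
        rw [div_le_div_iff₀ (by positivity) (by positivity)]
        have h : (p : ℝ) * p ≤ 4 * (p - 1) ^ 2 := by nlinarith
        nlinarith [mul_le_mul_of_nonneg_left h (sq_nonneg (Real.log p))]
end

section
/- Let p be an odd prime and let s be an integer with 0 ≤ s ≤ p−1. Then, in ℂ, (−1)^s = (2/p) · Σ_{ℓ=0}^{p−1} ω^{ℓ·s} / (1 + ω^{−ℓ}). -/
/-- If `z ^ n = 1` with `n` odd, the inverse of `1 + z` is half the alternating geometric sum. -/
theorem inv_one_add_eq_sum_of_pow_eq_one {K : Type*} [Field K] [NeZero (2 : K)] {n : ℕ}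
    (hn : Odd n) {z : K} (hz : z ^ n = 1) :
    (1 + z)⁻¹ = 2⁻¹ * ∑ j ∈ Finset.range n, (-1) ^ j * z ^ j := by
  have h : (1 + z) * ∑ j ∈ Finset.range n, (-1) ^ j * z ^ j = 2 := by
    have := mul_neg_geom_sum (-z) n
    rw [hn.neg_pow, hz] at this
    simp only [← mul_pow, neg_one_mul]
    linear_combination this
  refine inv_eq_of_mul_eq_one_right ?_
  rw [mul_left_comm, h, inv_mul_cancel₀ two_ne_zero]

/-- Orthogonality of the powers of a primitive root of unity. -/
theorem IsPrimitiveRoot.sum_pow_mul_zpow_neg_pow {K : Type*} [Field K] {n : ℕ} {ζ : K}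
    (hζ : IsPrimitiveRoot ζ n) {s j : ℕ} (hs : s < n) (hj : j < n) :
    ∑ ℓ ∈ Finset.range n, ζ ^ (ℓ * s) * (ζ ^ (-(ℓ : ℤ))) ^ j = if j = s then (n : K) else 0 := by
  have hζ0 : ζ ≠ 0 := hζ.ne_zero (by omega)
  have hterm (ℓ : ℕ) : ζ ^ (ℓ * s) * (ζ ^ (-(ℓ : ℤ))) ^ j = (ζ ^ s / ζ ^ j) ^ ℓ := by
    rw [zpow_neg, zpow_natCast, inv_pow, ← pow_mul, div_pow, ← pow_mul, ← pow_mul, mul_comm s,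
      mul_comm j, div_eq_mul_inv]
  simp only [hterm]
  split_ifs with h
  · simp [h, hζ0]
  · have hne : ζ ^ s / ζ ^ j ≠ 1 := fun h1 =>
      h (hζ.pow_inj hj hs ((div_eq_one_iff_eq (pow_ne_zero j hζ0)).mp h1).symm)
    rw [geom_sum_eq hne, div_pow, ← pow_mul, ← pow_mul, mul_comm s, mul_comm j, pow_mul, pow_mul,
      hζ.pow_eq_one]
    simp

/-- The powers of `-1` as an exponential sum over the powers of a primitive root of unity of odd
order. -/
theorem IsPrimitiveRoot.neg_one_pow_eq_sum {K : Type*} [Field K] [NeZero (2 : K)] {n : ℕ}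
    [NeZero (n : K)] {ζ : K} (hζ : IsPrimitiveRoot ζ n) (hn : Odd n) {s : ℕ} (hs : s < n) :
    (-1 : K) ^ s =
      2 / (n : K) * ∑ ℓ ∈ Finset.range n, ζ ^ (ℓ * s) / (1 + ζ ^ (-(ℓ : ℤ))) := by
  have hn0 : (n : K) ≠ 0 := NeZero.ne _
  have h2 : (2 : K) ≠ 0 := two_ne_zero
  have hpow (ℓ : ℕ) : (ζ ^ (-(ℓ : ℤ))) ^ n = 1 := by
    rw [zpow_neg, zpow_natCast, inv_pow, pow_right_comm, hζ.pow_eq_one, one_pow, inv_one]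
  have hsum : ∑ ℓ ∈ Finset.range n, ζ ^ (ℓ * s) / (1 + ζ ^ (-(ℓ : ℤ))) =
      2⁻¹ * ((-1) ^ s * n) := by
    calc
      _ = 2⁻¹ * ∑ j ∈ Finset.range n, (-1) ^ j *
          ∑ ℓ ∈ Finset.range n, ζ ^ (ℓ * s) * (ζ ^ (-(ℓ : ℤ))) ^ j := by
        simp only [div_eq_mul_inv, inv_one_add_eq_sum_of_pow_eq_one hn (hpow _), Finset.mul_sum]
        rw [Finset.sum_comm]
        refine Finset.sum_congr rfl fun j _ => Finset.sum_congr rfl fun ℓ _ => ?_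
        ring
      _ = 2⁻¹ * ∑ j ∈ Finset.range n, (-1) ^ j * (if j = s then (n : K) else 0) := by
        congr 1
        refine Finset.sum_congr rfl fun j hj => ?_
        rw [hζ.sum_pow_mul_zpow_neg_pow hs (Finset.mem_range.mp hj)]
      _ = _ := by simp [hs]
  rw [hsum]
  field_simp

/-- For an odd prime `p` and `0 ≤ s ≤ p-1`, with `ω = exp(2πi/p)`:
`(-1)^s = (2/p) · Σ_{ℓ=0}^{p-1} ω^{ℓs}/(1 + ω^{-ℓ})`. -/
theorem neg_one_pow_eq_sum (p : ℕ) (hp : Nat.Prime p) (hodd : Odd p)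
    (s : ℕ) (hs : s ≤ p - 1) :
    (-1 : ℂ) ^ s =
      (2 / (p : ℂ)) *
        ∑ ℓ ∈ Finset.range p,
          (Complex.exp (2 * Real.pi * Complex.I / p)) ^ (ℓ * s) /
            (1 + (Complex.exp (2 * Real.pi * Complex.I / p)) ^ (-(ℓ : ℤ))) := by
  have : NeZero (p : ℂ) := ⟨Nat.cast_ne_zero.mpr hp.ne_zero⟩
  exact (Complex.isPrimitiveRoot_exp p hp.ne_zero).neg_one_pow_eq_sum hodd
    (by have := hp.pos; omega)
end

section
/- Let p be an odd prime and let j, k be integers with 1 ≤ j ≤ p−1 and 1 ≤ k ≤ p−1. Then, in ℂ, (−1)^{(j·k mod p)} = (2/p) · Σ_{ℓ=0}^{p−1} ω^{ℓ·j·k} / (1 + ω^{−ℓ}), where (j·k mod p) denotes the remainder of j·k upon division by p. -/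
theorem two_div_one_add_eq_sum_neg_pow {K : Type*} [Field K] {n : ℕ} (hn : Odd n) {x : K}
    (hx : x ^ n = 1) (h0 : 1 + x ≠ 0) : 2 / (1 + x) = ∑ m ∈ Finset.range n, (-x) ^ m := by
  have h := mul_neg_geom_sum (-x) n
  rw [hn.neg_pow, hx] at h
  rw [div_eq_iff h0]
  linear_combination -h

theorem IsPrimitiveRoot.sum_range_pow_mul_inv_pow {K : Type*} [Field K] {n : ℕ} {ζ : K}
    (hζ : IsPrimitiveRoot ζ n) {a m : ℕ} (ha : a < n) (hm : m < n) :
    ∑ l ∈ Finset.range n, (ζ ^ a * (ζ ^ m)⁻¹) ^ l = if m = a then (n : K) else 0 := by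
  have hm0 : ζ ^ m ≠ 0 := pow_ne_zero _ (hζ.ne_zero (by omega))
  split_ifs with h
  · subst h
    simp [mul_inv_cancel₀ hm0]
  · have hne : 1 - ζ ^ a * (ζ ^ m)⁻¹ ≠ 0 := by
      intro h1
      rw [sub_eq_zero, eq_comm, mul_inv_eq_one₀ hm0] at h1
      exact h (hζ.pow_inj ha hm h1).symm
    refine (mul_eq_zero.mp ?_).resolve_left hne
    rw [mul_neg_geom_sum, mul_pow, inv_pow, pow_right_comm ζ a, pow_right_comm ζ m,
      hζ.pow_eq_one]
    simp

theorem IsPrimitiveRoot.two_mul_sum_pow_div_one_add {K : Type*} [Field K] [NeZero (2 : K)]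
    {n : ℕ} (hn : Odd n) {ζ : K} (hζ : IsPrimitiveRoot ζ n) (a : ℕ) :
    2 * ∑ l ∈ Finset.range n, ζ ^ (l * a) / (1 + ζ ^ (-(l : ℤ))) = n * (-1) ^ (a % n) := by
  have hpow (l : ℕ) : ((ζ ^ l)⁻¹) ^ n = 1 := by
    rw [inv_pow, pow_right_comm, hζ.pow_eq_one, one_pow, inv_one]
  have hne (l : ℕ) : 1 + (ζ ^ l)⁻¹ ≠ 0 := by
    intro h
    have h1 := hpow l
    rw [eq_neg_of_add_eq_zero_right h, hn.neg_one_pow] at h1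
    exact two_ne_zero (α := K) (by linear_combination -h1)
  have hterm (l : ℕ) : 2 * (ζ ^ (l * a) / (1 + ζ ^ (-(l : ℤ)))) =
      ∑ m ∈ Finset.range n, (-1) ^ m * (ζ ^ (a % n) * (ζ ^ m)⁻¹) ^ l := by
    rw [zpow_neg, zpow_natCast, mul_div_left_comm,
      two_div_one_add_eq_sum_neg_pow hn (hpow l) (hne l), Finset.mul_sum]
    refine Finset.sum_congr rfl fun m _ ↦ ?_
    rw [hζ.eq_orderOf, pow_mod_orderOf, neg_pow, mul_pow]
    simp only [inv_pow, ← pow_mul, mul_comm l]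
    ring
  have ha : a % n < n := Nat.mod_lt _ hn.pos
  rw [Finset.mul_sum, Finset.sum_congr rfl fun l _ ↦ hterm l, Finset.sum_comm]
  simp only [← Finset.mul_sum]
  rw [Finset.sum_congr rfl fun m hm ↦ by
    rw [hζ.sum_range_pow_mul_inv_pow ha (Finset.mem_range.mp hm)]]
  simp [ha, mul_comm]

/-- For an odd prime `p` and `1 ≤ j, k ≤ p-1`, with `ω = exp(2πi/p)`:
`(-1)^(jk mod p) = (2/p) · Σ_{ℓ=0}^{p-1} ω^{ℓjk}/(1 + ω^{-ℓ})`. -/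
theorem neg_one_pow_mod_eq_sum (p : ℕ) (hp : Nat.Prime p) (hodd : Odd p)
    (j k : ℕ) (hj1 : 1 ≤ j) (hj2 : j ≤ p - 1) (hk1 : 1 ≤ k) (hk2 : k ≤ p - 1) :
    (-1 : ℂ) ^ (j * k % p) =
      (2 / (p : ℂ)) *
        ∑ ℓ ∈ Finset.range p,
          (Complex.exp (2 * Real.pi * Complex.I / p)) ^ (ℓ * j * k) /
            (1 + (Complex.exp (2 * Real.pi * Complex.I / p)) ^ (-(ℓ : ℤ))) := by
  have hp0 : (p : ℂ) ≠ 0 := Nat.cast_ne_zero.mpr hp.ne_zero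
  have h := (Complex.isPrimitiveRoot_exp p hp.ne_zero).two_mul_sum_pow_div_one_add hodd (j * k)
  simp only [mul_assoc] at h ⊢
  rw [div_mul_eq_mul_div, h, mul_div_cancel_left₀ _ hp0]
end

section
/- There exists an absolute constant c₁ > 0 such that for every odd prime p, ‖Φ′‖ ≤ c₁ · √p · ln p. -/
open ZMod Finset in
/-- Parseval's inequality for exponential sums over `ZMod N` with distinct frequencies. -/
theorem sum_norm_sq_exponential_sum {N : ℕ} [NeZero N] {ι : Type*} [Fintype ι]
    {i : ι → ZMod N} (hi : Function.Injective i) (v : ι → ℂ) :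
    ∑ k : ZMod N, ‖∑ j, v j * stdAddChar (k * i j)‖ ^ 2 = N * ∑ j, ‖v j‖ ^ 2 := by
  classical
  have hconj (a : ZMod N) : (starRingEnd ℂ) (stdAddChar a) = stdAddChar (-a) :=
    (AddChar.map_neg_eq_conj _ a).symm
  have key (k : ZMod N) : ((‖∑ j, v j * stdAddChar (k * i j)‖ ^ 2 : ℝ) : ℂ) =
      ∑ j, ∑ l, v j * (starRingEnd ℂ) (v l) * stdAddChar (k * (i j - i l)) := by
    rw [Complex.ofReal_pow, ← Complex.mul_conj', map_sum, sum_mul_sum]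
    refine sum_congr rfl fun j _ => sum_congr rfl fun l _ => ?_
    rw [map_mul (starRingEnd ℂ), hconj, mul_sub, sub_eq_add_neg, AddChar.map_add_eq_mul]
    ring
  apply Complex.ofReal_injective
  rw [Complex.ofReal_sum]
  simp_rw [key]
  rw [sum_comm]
  push_cast
  rw [mul_sum]
  refine sum_congr rfl fun j _ => ?_
  rw [sum_comm]
  simp_rw [← mul_sum, AddChar.sum_mulShift _ (isPrimitive_stdAddChar N), sub_eq_zero, hi.eq_iff]
  simp [ZMod.card, Complex.mul_conj']
  ring

/-- A sum over `ZMod N` of a function of the canonical representative. -/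
theorem ZMod.sum_val {N : ℕ} [NeZero N] {E : Type*} [AddCommMonoid E] (f : ℕ → E) :
    ∑ z : ZMod N, f z.val = ∑ k ∈ Finset.range N, f k :=
  Finset.sum_nbij' ZMod.val Nat.cast (fun z _ => Finset.mem_range.2 z.val_lt) (by simp)
    (by simp) (fun k hk => ZMod.val_cast_of_lt (Finset.mem_range.1 hk)) (by simp)

open ZMod in
/-- The Fourier coefficients of the parity sign `z ↦ (-1) ^ z.val` on `ZMod N`, `N` odd. -/
theorem norm_dft_parity_le {N : ℕ} [NeZero N] (hN : Odd N) (t : ZMod N) :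
    ‖𝓕 (fun z : ZMod N => (-1 : ℂ) ^ z.val) t‖ ≤ N / |(N : ℝ) - 2 * t.val| := by
  have hN0 : (0 : ℝ) < N := Nat.cast_pos.2 (NeZero.pos N)
  set w : ℂ := -stdAddChar (-t) with hw
  have hsum : 𝓕 (fun z : ZMod N => (-1 : ℂ) ^ z.val) t = ∑ k ∈ Finset.range N, w ^ k := by
    rw [dft_apply, ← ZMod.sum_val]
    refine Finset.sum_congr rfl fun z _ => ?_
    have h : -(z * t) = z.val • (-t) := by simp
    rw [h, AddChar.map_nsmul_eq_pow, smul_eq_mul, ← mul_pow, hw, mul_neg_one]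
  have hpow : w ^ N = -1 := by
    rw [hw, hN.neg_pow, ← AddChar.map_nsmul_eq_pow]
    simp
  have hgeom := geom_sum_mul w N
  rw [← hsum, hpow] at hgeom
  set θ : ℝ := Real.pi * ((N : ℝ) - 2 * t.val) / N with hθ
  have hwexp : w = Complex.exp (Complex.I * θ) := by
    have h : stdAddChar (-t) = Complex.exp (2 * Real.pi * Complex.I * (-(t.val : ℤ) : ℤ) / N) := by
      rw [← stdAddChar_coe]; simp
    have hN' : (N : ℂ) ≠ 0 := by exact_mod_cast hN0.ne'
    have hs : Complex.I * (θ : ℂ) =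
        2 * Real.pi * Complex.I * (-(t.val : ℤ) : ℤ) / N + Real.pi * Complex.I := by
      rw [hθ]; push_cast; field_simp; ring
    rw [hw, h, hs, Complex.exp_add, Complex.exp_pi_mul_I, mul_neg_one]
  have ht : (t.val : ℝ) ≤ N := by exact_mod_cast t.val_lt.le
  have habs : |(N : ℝ) - 2 * t.val| ≤ N := by
    rw [abs_le]; constructor <;> linarith [(Nat.cast_nonneg t.val : (0 : ℝ) ≤ t.val)]
  have hpos : 0 < |(N : ℝ) - 2 * t.val| := by
    rw [abs_pos, sub_ne_zero]
    intro h
    have h' : N = 2 * t.val := by exact_mod_cast h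
    exact (Nat.not_even_iff_odd.2 hN) ⟨t.val, by omega⟩
  have hθabs : |θ / 2| = Real.pi / 2 * (|(N : ℝ) - 2 * t.val| / N) := by
    rw [hθ, abs_div, abs_div, abs_mul, abs_of_pos Real.pi_pos, abs_of_pos hN0, abs_two]
    ring
  have hsin : |(N : ℝ) - 2 * t.val| / N ≤ |Real.sin (θ / 2)| := by
    have h := Real.mul_abs_le_abs_sin (x := θ / 2) (by
      rw [hθabs]
      exact mul_le_of_le_one_right (by positivity) ((div_le_one hN0).2 habs))
    rw [hθabs] at h
    convert h using 1
    field_simp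
  have hw1 : ‖w - 1‖ = 2 * |Real.sin (θ / 2)| := by
    rw [hwexp, Complex.norm_exp_I_mul_ofReal_sub_one, Real.norm_eq_abs, abs_mul, abs_two]
  have hn := congrArg norm hgeom
  rw [norm_mul, hw1, show ((-1 : ℂ) - 1) = -2 by norm_num, norm_neg, Complex.norm_ofNat] at hn
  rw [le_div_iff₀ hpos]
  have h1 := mul_le_mul_of_nonneg_left hsin
    (norm_nonneg (𝓕 (fun z : ZMod N => (-1 : ℂ) ^ z.val) t))
  rw [mul_div_assoc', div_le_iff₀ hN0] at h1
  nlinarith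

/-- The reciprocals of the distances `|N - 2k|`, `k < N`, sum to `O(log N)` for odd `N`. -/
theorem sum_inv_abs_sub_two_mul_le {N : ℕ} (hN : Odd N) :
    ∑ k ∈ Finset.range N, |(N : ℝ) - 2 * k|⁻¹ ≤ 2 * (1 + Real.log N) := by
  obtain ⟨m, rfl⟩ := hN
  have hH (n : ℕ) (hn : n ≤ 2 * m + 1) :
      ∑ k ∈ Finset.range n, ((k : ℝ) + 1)⁻¹ ≤ 1 + Real.log (2 * m + 1 : ℕ) := by
    calc ∑ k ∈ Finset.range n, ((k : ℝ) + 1)⁻¹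
        ≤ ∑ k ∈ Finset.range (2 * m + 1), ((k : ℝ) + 1)⁻¹ :=
          Finset.sum_le_sum_of_subset_of_nonneg (Finset.range_mono hn)
            fun _ _ _ => by positivity
      _ = (harmonic (2 * m + 1) : ℝ) := by simp [harmonic]
      _ ≤ _ := harmonic_le_one_add_log _
  rw [show 2 * m + 1 = (m + 1) + m by ring, Finset.sum_range_add,
    show (m + 1) + m = 2 * m + 1 by ring, two_mul (1 + Real.log _)]
  refine add_le_add ?_ ?_
  · rw [← Finset.sum_range_reflect]
    refine (Finset.sum_le_sum fun k hk => ?_).trans (hH (m + 1) (by omega))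
    have hk' : k ≤ m := by simpa [Nat.lt_succ_iff] using hk
    have hc : ((m + 1 - 1 - k : ℕ) : ℝ) = m - k := by
      rw [Nat.add_sub_cancel, Nat.cast_sub hk']
    rw [hc]
    refine inv_anti₀ (by positivity) ((le_abs_self _).trans' ?_)
    push_cast
    linarith [(Nat.cast_nonneg k : (0 : ℝ) ≤ k)]
  · refine (Finset.sum_le_sum fun k _ => ?_).trans (hH m (by omega))
    refine inv_anti₀ (by positivity) ((neg_le_abs _).trans' ?_)
    push_cast
    linarith [(Nat.cast_nonneg k : (0 : ℝ) ≤ k)]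

open ZMod in
/-- The matrix of additive characters `e(t * (y * x))`, `t ≠ 0`, is bounded by `√p` on `ℓ²`. -/
theorem norm_exponential_sum_units_le {p : ℕ} [Fact p.Prime] {t : ZMod p} (ht : t ≠ 0)
    (v : (ZMod p)ˣ → ℂ) :
    ‖WithLp.toLp 2 fun x : (ZMod p)ˣ =>
        ∑ y : (ZMod p)ˣ, v y * stdAddChar (t * ((y : ZMod p) * (x : ZMod p)))‖ ≤
      √p * ‖WithLp.toLp 2 v‖ := by
  classical
  rw [EuclideanSpace.norm_eq, EuclideanSpace.norm_eq, ← Real.sqrt_mul (Nat.cast_nonneg p)]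
  refine Real.sqrt_le_sqrt ?_
  rw [← sum_norm_sq_exponential_sum (N := p) Units.val_injective v]
  have hinj : Function.Injective fun x : (ZMod p)ˣ => t * (x : ZMod p) :=
    (mul_right_injective₀ ht).comp Units.val_injective
  calc _ = ∑ k ∈ Finset.univ.image fun x : (ZMod p)ˣ => t * (x : ZMod p),
        ‖∑ y : (ZMod p)ˣ, v y * stdAddChar (k * (y : ZMod p))‖ ^ 2 := by
        rw [Finset.sum_image hinj.injOn]
        refine Finset.sum_congr rfl fun x _ => ?_
        simp only [mul_assoc, mul_comm (x : ZMod p)]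
    _ ≤ _ := Finset.sum_le_sum_of_subset_of_nonneg (Finset.subset_univ _)
        fun _ _ _ => by positivity

open ZMod in
/-- The all-ones matrix is bounded by `p` on `ℓ²` of the units of `ZMod p`. -/
theorem norm_const_sum_units_le {p : ℕ} [Fact p.Prime] (v : (ZMod p)ˣ → ℂ) :
    ‖WithLp.toLp 2 fun _ : (ZMod p)ˣ => ∑ y : (ZMod p)ˣ, v y‖ ≤ p * ‖WithLp.toLp 2 v‖ := by
  have hcard : (Fintype.card (ZMod p)ˣ : ℝ) ≤ p := by
    rw [ZMod.card_units_eq_totient]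
    exact_mod_cast Nat.totient_le p
  refine (sq_le_sq₀ (norm_nonneg _) (by positivity)).1 ?_
  rw [mul_pow, EuclideanSpace.norm_sq_eq, EuclideanSpace.norm_sq_eq]
  have h1 : ‖∑ y, v y‖ ^ 2 ≤ Fintype.card (ZMod p)ˣ * ∑ y, ‖v y‖ ^ 2 :=
    (pow_le_pow_left₀ (norm_nonneg _) (norm_sum_le _ _) 2).trans
      (by simpa using sq_sum_le_card_mul_sum_sq (s := Finset.univ) (f := fun y => ‖v y‖))
  have h0 : 0 ≤ ∑ y, ‖v y‖ ^ 2 := by positivity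
  simp only [Finset.sum_const, Finset.card_univ, nsmul_eq_mul]
  calc (Fintype.card (ZMod p)ˣ : ℝ) * ‖∑ y, v y‖ ^ 2
      ≤ p * (p * ∑ y, ‖v y‖ ^ 2) := by
        gcongr
        exact h1.trans (by gcongr)
    _ = _ := by ring

open ZMod in
/-- The matrix `(-1) ^ (y * x).val` acts on `ℓ²` with norm at most `1 + 2 √p (1 + log p)`. -/
theorem norm_parity_sum_units_le {p : ℕ} [Fact p.Prime] (hp : Odd p) (v : (ZMod p)ˣ → ℂ) :
    ‖WithLp.toLp 2 fun x : (ZMod p)ˣ =>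
        ∑ y : (ZMod p)ˣ, (-1 : ℂ) ^ ((y : ZMod p) * (x : ZMod p)).val * v y‖ ≤
      (1 + 2 * √p * (1 + Real.log p)) * ‖WithLp.toLp 2 v‖ := by
  have hp0 : (0 : ℝ) < p := Nat.cast_pos.2 (NeZero.pos p)
  set s : ZMod p → ℂ := fun z => (-1 : ℂ) ^ z.val with hs
  set F : ZMod p → EuclideanSpace ℂ (ZMod p)ˣ := fun t => WithLp.toLp 2 fun x : (ZMod p)ˣ =>
    ∑ y : (ZMod p)ˣ, v y * stdAddChar (t * ((y : ZMod p) * (x : ZMod p))) with hF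
  have hinv (z : ZMod p) : s z = ∑ t, ((p : ℂ)⁻¹ * 𝓕 s t) * stdAddChar (t * z) := by
    have h := invDFT_apply (𝓕 s) z
    rw [LinearEquiv.symm_apply_apply] at h
    rw [h, smul_eq_mul, Finset.mul_sum]
    exact Finset.sum_congr rfl fun t _ => by rw [smul_eq_mul]; ring
  have hdecomp : (WithLp.toLp 2 fun x : (ZMod p)ˣ =>
      ∑ y : (ZMod p)ˣ, (-1 : ℂ) ^ ((y : ZMod p) * (x : ZMod p)).val * v y) =
      ∑ t, ((p : ℂ)⁻¹ * 𝓕 s t) • F t := by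
    ext x
    have hz (y : (ZMod p)ˣ) : (-1 : ℂ) ^ ((y : ZMod p) * (x : ZMod p)).val = _ :=
      hinv ((y : ZMod p) * (x : ZMod p))
    simp only [hz, hF, WithLp.ofLp_sum, Finset.sum_apply, WithLp.ofLp_smul, Pi.smul_apply,
      smul_eq_mul, Finset.sum_mul, Finset.mul_sum]
    rw [Finset.sum_comm]
    exact Finset.sum_congr rfl fun t _ => Finset.sum_congr rfl fun y _ => by ring
  have hcoef (t : ZMod p) : ‖(p : ℂ)⁻¹ * 𝓕 s t‖ ≤ |(p : ℝ) - 2 * t.val|⁻¹ := by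
    rw [norm_mul, norm_inv, Complex.norm_natCast, inv_mul_le_iff₀ hp0, ← div_eq_mul_inv]
    exact norm_dft_parity_le hp t
  have hterm (t : ZMod p) : ‖((p : ℂ)⁻¹ * 𝓕 s t) • F t‖ ≤
      (if t = 0 then 1 else 0) * ‖WithLp.toLp 2 v‖ +
        |(p : ℝ) - 2 * t.val|⁻¹ * (√p * ‖WithLp.toLp 2 v‖) := by
    rw [norm_smul]
    rcases eq_or_ne t 0 with rfl | ht
    · have hF0 : ‖F 0‖ ≤ p * ‖WithLp.toLp 2 v‖ := by
        simpa [hF] using norm_const_sum_units_le v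
      have hc : ‖(p : ℂ)⁻¹ * 𝓕 s 0‖ ≤ (p : ℝ)⁻¹ := by
        simpa using hcoef 0
      calc ‖(p : ℂ)⁻¹ * 𝓕 s 0‖ * ‖F 0‖ ≤ (p : ℝ)⁻¹ * (p * ‖WithLp.toLp 2 v‖) := by gcongr
        _ = ‖WithLp.toLp 2 v‖ := by field_simp
        _ ≤ _ := by
          rw [if_pos rfl, one_mul]
          exact le_add_of_nonneg_right (by positivity)
    · rw [if_neg ht, zero_mul, zero_add]
      exact mul_le_mul (hcoef t) (norm_exponential_sum_units_le ht v) (norm_nonneg _)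
        (by positivity)
  rw [hdecomp]
  refine (norm_sum_le _ _).trans ((Finset.sum_le_sum fun t _ => hterm t).trans ?_)
  rw [Finset.sum_add_distrib, ← Finset.sum_mul, ← Finset.sum_mul, Finset.sum_ite_eq',
    if_pos (Finset.mem_univ _), ZMod.sum_val fun k => |(p : ℝ) - 2 * k|⁻¹]
  have h := mul_le_mul_of_nonneg_right (sum_inv_abs_sub_two_mul_le hp)
    (by positivity : 0 ≤ √(p : ℝ) * ‖WithLp.toLp 2 v‖)
  linarith

/-- There is an absolute constant `c₁ > 0` such that for every odd prime `p`, the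
spectral norm of the matrix `Φ′` with entries `Φ′_{x,y} = ε(y·x)` (for
`x, y ∈ (ZMod p)ˣ`, `ε(z) = (-1)^z.val`) is at most `c₁ ·√p · ln p`. -/
theorem spectral_norm_Phi'_le :
    ∃ c₁ : ℝ, 0 < c₁ ∧
      ∀ (p : ℕ) [Fact (Nat.Prime p)], Odd p →
        ‖Matrix.toEuclideanCLM (𝕜 := ℝ)
            (Matrix.of fun x y : (ZMod p)ˣ =>
              (-1 : ℝ) ^ ((y : ZMod p) * (x : ZMod p)).val)‖ ≤
          c₁ * Real.sqrt p * Real.log p := by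
  refine ⟨5, by norm_num, fun p hp hodd => ?_⟩
  have hp3 : (3 : ℝ) ≤ p := by
    have h2 := hp.out.two_le
    obtain ⟨m, hm⟩ := hodd
    exact_mod_cast (by omega : 3 ≤ p)
  have hlog : 1 ≤ Real.log p := by
    rw [Real.le_log_iff_exp_le (by linarith)]
    linarith [Real.exp_one_lt_d9]
  have hsqrt : 1 ≤ √(p : ℝ) := Real.one_le_sqrt.2 (by linarith)
  refine ContinuousLinearMap.opNorm_le_bound _ (by positivity) fun v => ?_
  have hcast (u : (ZMod p)ˣ → ℝ) :
      ‖(WithLp.toLp 2 u : EuclideanSpace ℝ (ZMod p)ˣ)‖ =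
        ‖(WithLp.toLp 2 fun x => (u x : ℂ) : EuclideanSpace ℂ (ZMod p)ˣ)‖ := by
    simp [EuclideanSpace.norm_eq]
  have hmain := norm_parity_sum_units_le hodd fun y => (v y : ℂ)
  rw [← hcast] at hmain
  have hA : ‖Matrix.toEuclideanCLM (𝕜 := ℝ) (Matrix.of fun x y : (ZMod p)ˣ =>
      (-1 : ℝ) ^ ((y : ZMod p) * (x : ZMod p)).val) v‖ =
      ‖WithLp.toLp 2 fun x : (ZMod p)ˣ =>
        ∑ y : (ZMod p)ˣ, (-1 : ℂ) ^ ((y : ZMod p) * (x : ZMod p)).val * (v y : ℂ)‖ := by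
    rw [← WithLp.toLp_ofLp 2 v, Matrix.toEuclideanCLM_toLp, hcast]
    simp [Matrix.mulVec, dotProduct]
  rw [hA]
  refine hmain.trans ?_
  gcongr
  nlinarith [mul_le_mul hsqrt hlog zero_le_one (by positivity)]
end

section
/- (Boas–Bellman inequality) Let E be a real inner product space, let m ≥ 1, and let h₁, …, h_m, g ∈ E. Then Σ_{i=1}^{m} ⟨h_i, g⟩² ≤ ‖g‖² · ( max_{1 ≤ i ≤ m} ‖h_i‖² + √( Σ_{i ≠ j} ⟨h_i, h_j⟩² ) ), where the inner sum ranges over ordered pairs (i,j) with 1 ≤ i, j ≤ m and i ≠ j. -/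
open scoped RealInnerProductSpace

/-- A linear combination `∑ i, c i • h i` has squared norm at most `(M + √T) * ∑ i, c i ^ 2`, where
`M` bounds the `‖h i‖ ^ 2` and `T` is the sum of the squared off-diagonal Gram entries. -/
theorem norm_sum_smul_sq_le_of_norm_sq_le {ι E : Type*} [Fintype ι] [DecidableEq ι]
    [NormedAddCommGroup E] [InnerProductSpace ℝ E] (c : ι → ℝ) (h : ι → E) {M : ℝ}
    (hM : ∀ i, ‖h i‖ ^ 2 ≤ M) :
    ‖∑ i, c i • h i‖ ^ 2 ≤
      (M + Real.sqrt (∑ q ∈ (Finset.univ : Finset (ι × ι)).filter (fun q => q.1 ≠ q.2),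
        ⟪h q.1, h q.2⟫ ^ 2)) * ∑ i, c i ^ 2 := by
  have expand : ‖∑ i, c i • h i‖ ^ 2 = ∑ q : ι × ι, (c q.1 * c q.2) * ⟪h q.1, h q.2⟫ := by
    rw [← real_inner_self_eq_norm_sq, sum_inner, Fintype.sum_prod_type]
    simp only [inner_sum, real_inner_smul_left, real_inner_smul_right, mul_assoc, mul_left_comm]
  have diagonal : ∑ q ∈ (Finset.univ : Finset (ι × ι)).filter (fun q => ¬ q.1 ≠ q.2),
      (c q.1 * c q.2) * ⟪h q.1, h q.2⟫ = ∑ i, c i ^ 2 * ‖h i‖ ^ 2 := by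
    rw [Finset.sum_filter, Fintype.sum_prod_type]
    simp [pow_two]
  have diagonal_le : ∑ i, c i ^ 2 * ‖h i‖ ^ 2 ≤ M * ∑ i, c i ^ 2 := by
    rw [Finset.mul_sum]
    refine Finset.sum_le_sum fun i _ => ?_
    rw [mul_comm M]
    exact mul_le_mul_of_nonneg_left (hM i) (sq_nonneg _)
  have coeff_le : Real.sqrt (∑ q ∈ (Finset.univ : Finset (ι × ι)).filter (fun q => q.1 ≠ q.2),
      (c q.1 * c q.2) ^ 2) ≤ ∑ i, c i ^ 2 := by
    refine Real.sqrt_le_iff.2 ⟨by positivity, ?_⟩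
    calc _ ≤ ∑ q : ι × ι, (c q.1 * c q.2) ^ 2 :=
          Finset.sum_le_sum_of_subset_of_nonneg (Finset.filter_subset _ _)
            fun _ _ _ => sq_nonneg _
      _ = (∑ i, c i ^ 2) ^ 2 := by
          rw [Fintype.sum_prod_type, pow_two (∑ i, c i ^ 2), Finset.sum_mul_sum]
          simp only [mul_pow]
  have off_diagonal_le := (Real.sum_mul_le_sqrt_mul_sqrt
    ((Finset.univ : Finset (ι × ι)).filter (fun q => q.1 ≠ q.2))
    (fun q => c q.1 * c q.2) (fun q => ⟪h q.1, h q.2⟫)).trans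
      (mul_le_mul_of_nonneg_right coeff_le (Real.sqrt_nonneg _))
  rw [expand, ← Finset.sum_filter_add_sum_filter_not _ (fun q : ι × ι => q.1 ≠ q.2), diagonal]
  linarith

/-- **Boas–Bellman inequality.** For elements `h 1, …, h m, g` of a real inner product
space, `Σ_i ⟪h i, g⟫² ≤ ‖g‖² · (max_i ‖h i‖² + √(Σ_{i ≠ j} ⟪h i, h j⟫²))`. -/
theorem boas_bellman {E : Type*} [NormedAddCommGroup E] [InnerProductSpace ℝ E]
    (m : ℕ) (hm : 1 ≤ m) (h : Fin m → E) (g : E) :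
    ∑ i : Fin m, ⟪h i, g⟫ ^ 2 ≤
      ‖g‖ ^ 2 *
        ((Finset.univ.sup' ⟨⟨0, hm⟩, Finset.mem_univ _⟩ fun i : Fin m => ‖h i‖ ^ 2) +
          Real.sqrt (∑ q ∈ (Finset.univ : Finset (Fin m × Fin m)).filter
              (fun q => q.1 ≠ q.2), ⟪h q.1, h q.2⟫ ^ 2)) := by
  set M := Finset.univ.sup' ⟨⟨0, hm⟩, Finset.mem_univ _⟩ fun i : Fin m => ‖h i‖ ^ 2
  have hM : ∀ i, ‖h i‖ ^ 2 ≤ M := fun i =>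
    Finset.le_sup' (fun i : Fin m => ‖h i‖ ^ 2) (Finset.mem_univ i)
  have hv := norm_sum_smul_sq_le_of_norm_sq_le (fun i => ⟪h i, g⟫) h hM
  have hS : ∑ i, ⟪h i, g⟫ ^ 2 = ⟪∑ i, ⟪h i, g⟫ • h i, g⟫ := by
    simp only [sum_inner, real_inner_smul_left, pow_two]
  have cauchy_schwarz : (∑ i, ⟪h i, g⟫ ^ 2) ^ 2 ≤ ‖∑ i, ⟪h i, g⟫ • h i‖ ^ 2 * ‖g‖ ^ 2 := by
    rw [hS, ← mul_pow]
    exact sq_le_sq' (neg_le_of_abs_le (abs_real_inner_le_norm _ _)) (real_inner_le_norm _ _)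
  have hM0 : 0 ≤ M := (sq_nonneg _).trans (hM ⟨0, hm⟩)
  have hS0 : 0 ≤ ∑ i, ⟪h i, g⟫ ^ 2 := by positivity
  rcases hS0.eq_or_lt with hzero | hpos
  · rw [← hzero]
    positivity
  · refine le_of_mul_le_mul_right ?_ hpos
    have := mul_le_mul_of_nonneg_right hv (sq_nonneg ‖g‖)
    linarith
end

section
/- There exists an absolute constant c > 0 such that for every odd prime p and every function g : (ZMod p)ˣ → ℝ, (1/(p−1)) · Σ_{a ∈ (ZMod p)ˣ} ( (1/(p−1)) · Σ_{x ∈ (ZMod p)ˣ} h_a(x) · g(x) )² ≤ c · (ln p / √p) · (1/(p−1)) · Σ_{x ∈ (ZMod p)ˣ} g(x)². -/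
open Finset

theorem norm_one_add_stdAddChar_ge {p : ℕ} [NeZero p] (t : ZMod p) :
    2 * |(p : ℝ) - 2 * t.val| / p ≤ ‖1 + ZMod.stdAddChar t‖ := by
  have hp : (0 : ℝ) < p := Nat.cast_pos.mpr (NeZero.pos p)
  have ht : (t.val : ℝ) ≤ p := Nat.cast_le.mpr (ZMod.val_lt t).le
  have ht0 : (0 : ℝ) ≤ t.val := Nat.cast_nonneg _
  set y : ℝ := Real.pi * (2 * t.val - p) / (2 * p) with hy
  have hyabs : |y| = Real.pi / (2 * p) * |(p : ℝ) - 2 * t.val| := by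
    rw [abs_sub_comm, hy, mul_div_right_comm, abs_mul, abs_of_pos (by positivity)]
  have hle : |(p : ℝ) - 2 * t.val| ≤ p := abs_le.mpr ⟨by linarith, by linarith⟩
  have hbound : |y| ≤ Real.pi / 2 := by
    rw [hyabs]
    calc _ ≤ Real.pi / (2 * p) * p := by gcongr
      _ = _ := by field_simp
  have hsin := Real.mul_abs_le_abs_sin hbound
  have hexp : 1 + ZMod.stdAddChar t = -(Complex.exp (Complex.I * (2 * y : ℝ)) - 1) := by
    have : ZMod.stdAddChar t = Complex.exp (2 * Real.pi * Complex.I * t.val / p) := by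
      rw [← ZMod.toCircle_natCast, ZMod.natCast_zmod_val, ZMod.stdAddChar_apply]
    rw [this, show 2 * Real.pi * Complex.I * t.val / p
      = Complex.I * (2 * y : ℝ) + Real.pi * Complex.I by
        have : (p : ℂ) ≠ 0 := NeZero.ne _
        rw [hy]; push_cast; field_simp; ring, Complex.exp_add, Complex.exp_pi_mul_I]
    ring
  rw [hexp, norm_neg, Complex.norm_exp_I_mul_ofReal_sub_one, norm_mul, Real.norm_eq_abs,
    Real.norm_eq_abs, abs_two, mul_div_cancel_left₀ _ two_ne_zero]
  rw [hyabs] at hsin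
  calc _ = 2 * (2 / Real.pi * (Real.pi / (2 * p) * |(p : ℝ) - 2 * t.val|)) := by
        field_simp
    _ ≤ _ := by gcongr

theorem sum_range_inv_abs_sub_two_mul_le_s15 (m : ℕ) :
    ∑ t ∈ range (2 * m + 1), |((2 * m + 1 : ℕ) : ℝ) - 2 * t|⁻¹ ≤
      2 * (1 + Real.log (2 * m + 1 : ℕ)) := by
  have hharm (n : ℕ) (hn : n ≤ m + 1) :
      ∑ j ∈ range n, (2 * (j : ℝ) + 1)⁻¹ ≤ 1 + Real.log (2 * m + 1 : ℕ) := by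
    rcases Nat.eq_zero_or_pos m with rfl | hm
    · interval_cases n <;> simp
    rcases Nat.eq_zero_or_pos n with rfl | hn0
    · simp only [range_zero, sum_empty]; positivity
    calc _ ≤ ∑ j ∈ range n, ((j : ℝ) + 1)⁻¹ := by
          gcongr with j
          linarith [(Nat.cast_nonneg j : (0 : ℝ) ≤ j)]
      _ = (harmonic n : ℝ) := by simp [harmonic]
      _ ≤ 1 + Real.log n := harmonic_le_one_add_log n
      _ ≤ _ := by gcongr; omega
  rw [show 2 * m + 1 = (m + 1) + m by ring, sum_range_add, two_mul (1 + Real.log _),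
    show (m + 1) + m = 2 * m + 1 by ring]
  refine add_le_add ?_ ?_
  · rw [← sum_range_reflect]
    refine le_of_eq_of_le (sum_congr rfl fun j hj ↦ ?_) (hharm (m + 1) le_rfl)
    rw [mem_range] at hj
    rw [show m + 1 - 1 - j = m - j by omega, Nat.cast_sub (by omega)]
    push_cast
    rw [abs_of_nonneg] <;> ring_nf; positivity
  · refine le_of_eq_of_le (sum_congr rfl fun j hj ↦ ?_) (hharm m (by omega))
    rw [abs_sub_comm, abs_of_nonneg] <;> push_cast <;> ring_nf; positivity

theorem sum_norm_sq_sum_stdAddChar_mul {p : ℕ} [NeZero p] (f : ZMod p → ℂ) :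
    ∑ b : ZMod p, ‖∑ x, ZMod.stdAddChar (b * x) * f x‖ ^ 2 = p * ∑ x, ‖f x‖ ^ 2 := by
  have key : ∑ b : ZMod p, (∑ x, ZMod.stdAddChar (b * x) * f x) *
      (starRingEnd ℂ) (∑ x, ZMod.stdAddChar (b * x) * f x) =
        p * ∑ x, f x * (starRingEnd ℂ) (f x) := by
    calc _ = ∑ b : ZMod p, ∑ x, ∑ y, ZMod.stdAddChar (b * (x - y)) *
            (f x * (starRingEnd ℂ) (f y)) := by
          refine sum_congr rfl fun b _ ↦ ?_
          rw [map_sum, sum_mul_sum]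
          refine sum_congr rfl fun x _ ↦ sum_congr rfl fun y _ ↦ ?_
          rw [RingHom.map_mul, ← AddChar.map_neg_eq_conj, mul_sub, sub_eq_add_neg,
            AddChar.map_add_eq_mul]
          ring
      _ = ∑ x, ∑ y, (∑ b : ZMod p, ZMod.stdAddChar (b * (x - y))) *
            (f x * (starRingEnd ℂ) (f y)) := by
          rw [sum_comm]
          refine sum_congr rfl fun x _ ↦ ?_
          rw [sum_comm]
          simp_rw [sum_mul]
      _ = _ := by
          simp_rw [AddChar.sum_mulShift _ (ZMod.isPrimitive_stdAddChar p), sub_eq_zero, mul_sum]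
          simp
  simp_rw [Complex.mul_conj, Complex.normSq_eq_norm_sq] at key
  exact_mod_cast key

theorem sum_units_norm_sq_sum_stdAddChar_mul_le {p : ℕ} [Fact p.Prime] {t : ZMod p} (ht : t ≠ 0)
    (g : (ZMod p)ˣ → ℂ) :
    ∑ a : (ZMod p)ˣ,
        ‖∑ x : (ZMod p)ˣ, ZMod.stdAddChar (t * ((a⁻¹ * x : (ZMod p)ˣ) : ZMod p)) * g x‖ ^ 2 ≤
      p * ∑ x, ‖g x‖ ^ 2 := by
  have hinj : Function.Injective ((↑) : (ZMod p)ˣ → ZMod p) := Units.val_injective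
  set f : ZMod p → ℂ := Function.extend ((↑) : (ZMod p)ˣ → ZMod p) g 0 with hf
  have hf0 (z) (hz : z ∉ Set.range ((↑) : (ZMod p)ˣ → ZMod p)) : f z = 0 := by
    rw [hf, Function.extend_apply' _ _ _ hz, Pi.zero_apply]
  have hfg (x : (ZMod p)ˣ) : f x = g x := hinj.extend_apply g 0 x
  have hsum : ∑ x, ‖g x‖ ^ 2 = ∑ z, ‖f z‖ ^ 2 :=
    Fintype.sum_of_injective _ hinj _ _ (fun z hz ↦ by simp [hf0 z hz]) (fun x ↦ by rw [hfg])
  have hterm (a : (ZMod p)ˣ) :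
      ∑ x : (ZMod p)ˣ, ZMod.stdAddChar (t * ((a⁻¹ * x : (ZMod p)ˣ) : ZMod p)) * g x =
      ∑ z, ZMod.stdAddChar (t * ((a⁻¹ : (ZMod p)ˣ) : ZMod p) * z) * f z :=
    Fintype.sum_of_injective _ hinj _ _ (fun z hz ↦ by rw [hf0 z hz, mul_zero])
      (fun x ↦ by rw [hfg, Units.val_mul, mul_assoc])
  have hinj' : Function.Injective fun a : (ZMod p)ˣ ↦ t * ((a⁻¹ : (ZMod p)ˣ) : ZMod p) :=
    (mul_right_injective₀ ht).comp (hinj.comp inv_injective)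
  rw [hsum, ← sum_norm_sq_sum_stdAddChar_mul]
  simp_rw [hterm]
  rw [← sum_image (g := fun a : (ZMod p)ˣ ↦ t * ((a⁻¹ : (ZMod p)ˣ) : ZMod p))
    (f := fun b ↦ ‖∑ z, ZMod.stdAddChar (b * z) * f z‖ ^ 2) hinj'.injOn]
  exact sum_le_univ_sum_of_nonneg fun _ ↦ by positivity

theorem sum_units_norm_sq_sum_le {p : ℕ} [Fact p.Prime] (g : (ZMod p)ˣ → ℂ) :
    ∑ _a : (ZMod p)ˣ, ‖∑ x : (ZMod p)ˣ, g x‖ ^ 2 ≤ p ^ 2 * ∑ x, ‖g x‖ ^ 2 := by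
  have hcard : (Fintype.card (ZMod p)ˣ : ℝ) ≤ p := by
    rw [ZMod.card_units]; exact_mod_cast Nat.sub_le p 1
  have hcs : ‖∑ x : (ZMod p)ˣ, g x‖ ^ 2 ≤ Fintype.card (ZMod p)ˣ * ∑ x, ‖g x‖ ^ 2 := by
    grw [norm_sum_le]
    exact sq_sum_le_card_mul_sum_sq
  rw [sum_const, nsmul_eq_mul, card_univ]
  calc _ ≤ (p : ℝ) * (p * ∑ x, ‖g x‖ ^ 2) := by grw [hcs]; gcongr
    _ = _ := by ring

theorem sum_units_norm_sq_convolution_le {p : ℕ} [Fact p.Prime] (Φ : ZMod p → ℂ)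
    (g : (ZMod p)ˣ → ℂ) :
    ∑ a : (ZMod p)ˣ, ‖∑ x : (ZMod p)ˣ, Φ (a⁻¹ * x : (ZMod p)ˣ) * g x‖ ^ 2 ≤
      (p : ℝ)⁻¹ * (∑ t, ‖ZMod.dft Φ t‖) * (∑ t, ‖ZMod.dft Φ t‖ + p * ‖ZMod.dft Φ 0‖) *
        ∑ x, ‖g x‖ ^ 2 := by
  have hp : (0 : ℝ) < p := Nat.cast_pos.mpr (NeZero.pos p)
  set c : ZMod p → ℂ := ZMod.dft Φ with hc
  set E : ZMod p → (ZMod p)ˣ → ℂ := fun t a ↦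
    ∑ x : (ZMod p)ˣ, ZMod.stdAddChar (t * ((a⁻¹ * x : (ZMod p)ˣ) : ZMod p)) * g x with hE
  have hexp (a : (ZMod p)ˣ) : ∑ x : (ZMod p)ˣ, Φ (a⁻¹ * x : (ZMod p)ˣ) * g x =
      (p : ℂ)⁻¹ * ∑ t, c t * E t a := by
    have hΦ (z) : Φ z = (p : ℂ)⁻¹ * ∑ t, ZMod.stdAddChar (t * z) * c t := by
      conv_lhs => rw [← ZMod.dft.symm_apply_apply Φ]
      rw [ZMod.invDFT_apply]
      simp [hc]
    simp_rw [hΦ, hE, mul_sum, sum_mul]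
    rw [sum_comm]
    exact sum_congr rfl fun t _ ↦ sum_congr rfl fun x _ ↦ by ring
  have hcs (a : (ZMod p)ˣ) : ‖∑ t, c t * E t a‖ ^ 2 ≤
      (∑ t, ‖c t‖) * ∑ t, ‖c t‖ * ‖E t a‖ ^ 2 := by
    grw [norm_sum_le]
    exact sum_sq_le_sum_mul_sum_of_sq_le_mul _ (fun _ _ ↦ norm_nonneg _)
      (fun _ _ ↦ by positivity) (fun _ _ ↦ by rw [norm_mul]; exact le_of_eq (by ring))
  have hEt (t : ZMod p) : ‖c t‖ * ∑ a, ‖E t a‖ ^ 2 ≤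
      p * (∑ x, ‖g x‖ ^ 2) * (‖c t‖ + if t = 0 then p * ‖c 0‖ else 0) := by
    split_ifs with h
    · subst h
      have h0 := sum_units_norm_sq_sum_le g
      simp only [hE, zero_mul, AddChar.map_zero_eq_one, one_mul]
      grw [h0]
      have : 0 ≤ p * (∑ x, ‖g x‖ ^ 2) * ‖c 0‖ := by positivity
      linarith
    · grw [sum_units_norm_sq_sum_stdAddChar_mul_le h g]
      exact le_of_eq (by ring)
  calc _ ≤ ∑ a : (ZMod p)ˣ, ((p : ℝ)⁻¹) ^ 2 * ((∑ t, ‖c t‖) * ∑ t, ‖c t‖ * ‖E t a‖ ^ 2) := by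
        refine sum_le_sum fun a _ ↦ ?_
        rw [hexp, norm_mul, norm_inv, Complex.norm_natCast, mul_pow]
        grw [hcs]
    _ = ((p : ℝ)⁻¹) ^ 2 * (∑ t, ‖c t‖) * ∑ t, ‖c t‖ * ∑ a, ‖E t a‖ ^ 2 := by
        rw [← mul_sum, ← mul_sum, sum_comm, mul_assoc]
        simp_rw [mul_sum]
    _ ≤ ((p : ℝ)⁻¹) ^ 2 * (∑ t, ‖c t‖) *
          ∑ t, p * (∑ x, ‖g x‖ ^ 2) * (‖c t‖ + if t = 0 then p * ‖c 0‖ else 0) := by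
        exact mul_le_mul_of_nonneg_left (sum_le_sum fun t _ ↦ hEt t) (by positivity)
    _ = _ := by
        rw [← mul_sum, sum_add_distrib, sum_ite_eq' univ (0 : ZMod p), if_pos (mem_univ _)]
        field_simp

theorem norm_dft_neg_one_pow_val_le {p : ℕ} [NeZero p] (hp : Odd p) (t : ZMod p) :
    ‖ZMod.dft (fun z : ZMod p ↦ (-1 : ℂ) ^ z.val) t‖ ≤ p * |(p : ℝ) - 2 * t.val|⁻¹ := by
  have hp0 : (0 : ℝ) < p := Nat.cast_pos.mpr (NeZero.pos p)
  set w : ℂ := ZMod.stdAddChar (-t) with hw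
  have hsum : ZMod.dft (fun z : ZMod p ↦ (-1 : ℂ) ^ z.val) t = ∑ k ∈ range p, (-w) ^ k := by
    rw [ZMod.dft_apply]
    refine sum_bij (fun z _ ↦ z.val) (fun z _ ↦ mem_range.mpr z.val_lt)
      (fun _ _ _ _ h ↦ ZMod.val_injective p h)
      (fun k hk ↦ ⟨k, mem_univ _, ZMod.val_cast_of_lt (mem_range.mp hk)⟩) (fun z _ ↦ ?_)
    rw [neg_pow w, hw, ← AddChar.map_nsmul_eq_pow, nsmul_eq_mul, ZMod.natCast_zmod_val, mul_neg,
      smul_eq_mul, mul_comm]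
  have hwp : w ^ p = 1 := by
    rw [hw, ← AddChar.map_nsmul_eq_pow, nsmul_eq_mul, ZMod.natCast_self, zero_mul,
      AddChar.map_zero_eq_one]
  have hnorm : ‖1 + w‖ = ‖1 + ZMod.stdAddChar t‖ := by
    rw [hw, AddChar.map_neg_eq_conj, ← RCLike.norm_conj, map_add, map_one, Complex.conj_conj]
  have hgeom := congr_arg norm (geom_sum_mul_neg (-w) p)
  rw [← hsum, hp.neg_pow, hwp, sub_neg_eq_add, sub_neg_eq_add, norm_mul, one_add_one_eq_two,
    Complex.norm_two, hnorm] at hgeom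
  have hpos : 0 < |(p : ℝ) - 2 * t.val| := by
    rw [abs_pos, sub_ne_zero]
    intro h
    have h' : p = 2 * t.val := by exact_mod_cast h
    exact Nat.not_even_iff_odd.mpr hp (h' ▸ even_two_mul _)
  have hlow := norm_one_add_stdAddChar_ge t
  rw [← div_eq_mul_inv, le_div_iff₀ hpos]
  have := mul_le_mul_of_nonneg_left hlow
    (norm_nonneg (ZMod.dft (fun z : ZMod p ↦ (-1 : ℂ) ^ z.val) t))
  rw [hgeom, mul_div_assoc', div_le_iff₀ hp0] at this
  linarith

theorem sum_norm_dft_neg_one_pow_val_le {p : ℕ} [NeZero p] (hp : Odd p) :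
    ∑ t, ‖ZMod.dft (fun z : ZMod p ↦ (-1 : ℂ) ^ z.val) t‖ ≤ p * (2 * (1 + Real.log p)) := by
  calc _ ≤ ∑ t : ZMod p, p * |(p : ℝ) - 2 * t.val|⁻¹ :=
        sum_le_sum fun t _ ↦ norm_dft_neg_one_pow_val_le hp t
    _ = p * ∑ k ∈ range p, |(p : ℝ) - 2 * k|⁻¹ := by
        rw [← mul_sum]
        congr 1
        exact sum_bij (fun z _ ↦ z.val) (fun z _ ↦ mem_range.mpr z.val_lt)
          (fun _ _ _ _ h ↦ ZMod.val_injective p h)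
          (fun k hk ↦ ⟨k, mem_univ _, ZMod.val_cast_of_lt (mem_range.mp hk)⟩) (fun z _ ↦ rfl)
    _ ≤ _ := by
        gcongr
        obtain ⟨m, rfl⟩ := hp
        exact sum_range_inv_abs_sub_two_mul_le_s15 m

theorem sum_units_sq_neg_one_pow_convolution_le {p : ℕ} [Fact p.Prime] (hp : Odd p)
    (g : (ZMod p)ˣ → ℝ) :
    ∑ a : (ZMod p)ˣ, (∑ x : (ZMod p)ˣ, (-1 : ℝ) ^ ((a⁻¹ * x : (ZMod p)ˣ) : ZMod p).val * g x) ^ 2 ≤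
      6 * p * (1 + Real.log p) ^ 2 * ∑ x, g x ^ 2 := by
  have hp0 : (0 : ℝ) < p := Nat.cast_pos.mpr (NeZero.pos p)
  have hlog : 0 ≤ Real.log p := Real.log_natCast_nonneg p
  have h0 : ‖ZMod.dft (fun z : ZMod p ↦ (-1 : ℂ) ^ z.val) 0‖ ≤ 1 := by
    refine (norm_dft_neg_one_pow_val_le hp 0).trans_eq ?_
    rw [ZMod.val_zero, Nat.cast_zero, mul_zero, sub_zero, abs_of_pos hp0, mul_inv_cancel₀ hp0.ne']
  have h := sum_units_norm_sq_convolution_le (fun z : ZMod p ↦ (-1 : ℂ) ^ z.val) (fun x ↦ (g x : ℂ))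
  have hreal (a : (ZMod p)ˣ) :
      ‖∑ x : (ZMod p)ˣ, (-1 : ℂ) ^ ((a⁻¹ * x : (ZMod p)ˣ) : ZMod p).val * (g x : ℂ)‖ ^ 2 =
      (∑ x : (ZMod p)ˣ, (-1 : ℝ) ^ ((a⁻¹ * x : (ZMod p)ˣ) : ZMod p).val * g x) ^ 2 := by
    rw [← sq_abs (∑ x : (ZMod p)ˣ, _), ← Real.norm_eq_abs, ← Complex.norm_real]
    push_cast
    rfl
  simp_rw [hreal, Complex.norm_real, Real.norm_eq_abs, sq_abs] at h
  refine h.trans (mul_le_mul_of_nonneg_right ?_ (sum_nonneg fun _ _ ↦ sq_nonneg _))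
  have hL := sum_norm_dft_neg_one_pow_val_le hp
  calc _ ≤ (p : ℝ)⁻¹ * (p * (2 * (1 + Real.log p))) * (p * (2 * (1 + Real.log p)) + p * 1) := by
        gcongr
    _ = 2 * (1 + Real.log p) * p * (2 * (1 + Real.log p) + 1) := by
        field_simp
    _ ≤ _ := by nlinarith [mul_nonneg hp0.le hlog, mul_nonneg hp0.le (sq_nonneg (Real.log p))]


/-- There is an absolute constant `c > 0` such that for every odd prime `p` and every
`g : (ZMod p)ˣ → ℝ`,
`(1/(p-1)) · Σ_a ((1/(p-1)) · Σ_x h_a(x)·g(x))² ≤ c · (ln p/√p) · (1/(p-1)) · Σ_x g(x)²`,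
where `h_a(x) = (-1)^((a⁻¹·x).val)` is the parity bit of the discrete logarithm of `x` to
base `a` in `(ZMod p, +)`. -/
theorem avg_sq_inner_with_g_le :
    ∃ c : ℝ, 0 < c ∧
      ∀ (p : ℕ) [Fact (Nat.Prime p)], Odd p →
        ∀ g : (ZMod p)ˣ → ℝ,
          (1 / ((p : ℝ) - 1)) *
              ∑ a : (ZMod p)ˣ,
                ((1 / ((p : ℝ) - 1)) *
                    ∑ x : (ZMod p)ˣ,
                      (-1 : ℝ) ^ (((a⁻¹ * x : (ZMod p)ˣ) : ZMod p)).val * g x) ^ 2 ≤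
            c * (Real.log p / Real.sqrt p) *
              ((1 / ((p : ℝ) - 1)) * ∑ x : (ZMod p)ˣ, g x ^ 2) := by
  refine ⟨108, by norm_num, fun p _ hodd g ↦ ?_⟩
  have hp3 : (3 : ℝ) ≤ p := by
    have h2 := (Fact.out : p.Prime).two_le
    obtain ⟨m, hm⟩ := hodd
    exact_mod_cast (by omega : 3 ≤ p)
  have hn : (0 : ℝ) < p - 1 := by linarith
  have hs : 0 < √(p : ℝ) := Real.sqrt_pos.mpr (by linarith)
  have hss : √(p : ℝ) ^ 2 = p := Real.sq_sqrt (by linarith)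
  have hlog1 : 1 ≤ Real.log p := by
    rw [Real.le_log_iff_exp_le (by linarith)]
    linarith [Real.exp_one_lt_d9]
  have hlog2 : Real.log p ≤ 2 * √(p : ℝ) := by
    have h := Real.log_le_self hs.le
    rw [Real.log_sqrt (by linarith)] at h
    linarith
  have hmain := sum_units_sq_neg_one_pow_convolution_le hodd g
  have hG : 0 ≤ ∑ x, g x ^ 2 := sum_nonneg fun _ _ ↦ sq_nonneg _
  have hcoef : 6 * p * (1 + Real.log p) ^ 2 ≤
      108 * (Real.log p / √(p : ℝ)) * ((p : ℝ) - 1) ^ 2 := by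
    calc 6 * p * (1 + Real.log p) ^ 2 ≤ 6 * p * (2 * Real.log p) ^ 2 := by gcongr; linarith
      _ = 24 * p * Real.log p * Real.log p := by ring
      _ ≤ 24 * p * Real.log p * (2 * √(p : ℝ)) := by gcongr
      _ = 108 * (Real.log p / √(p : ℝ)) * (2 / 3 * (p : ℝ)) ^ 2 := by
          field_simp
          rw [hss]
          ring
      _ ≤ _ := by gcongr; linarith
  simp_rw [mul_pow, ← mul_sum]
  grw [hmain, hcoef]
  exact le_of_eq (by field_simp)
end

section
/- Let p be an odd prime, let W be a real Hilbert space, w₀ ∈ W, and let f and g be as in the context. For each a ∈ (ZMod p)ˣ define the square-loss objective L_a : W → ℝ by L_a(w) = (1/(p−1)) · Σ_{x ∈ (ZMod p)ˣ} ½·(f(w)(x) − h_a(x))². Then the average gradient satisfies (1/(p−1)) · Σ_{a ∈ (ZMod p)ˣ} ∇L_a(w₀) = (1/(p−1)) · Σ_{x ∈ (ZMod p)ˣ} f(w₀)(x) • g(x); in particular it does not depend on the functions h_a. -/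
/-- Negation on the nonzero residues modulo an odd prime flips the parity of the canonical
representative. -/
lemma ZMod.neg_one_pow_val_neg_unit {p : ℕ} [Fact p.Prime] (hp : Odd p) (u : (ZMod p)ˣ) :
    (-1 : ℝ) ^ ((-u : (ZMod p)ˣ) : ZMod p).val = -(-1 : ℝ) ^ (u : ZMod p).val := by
  have : NeZero (u : ZMod p) := ⟨u.ne_zero⟩
  have hlt := ZMod.val_lt (u : ZMod p)
  rw [Units.val_neg, ZMod.val_neg_of_ne_zero]
  rcases Nat.even_or_odd (u : ZMod p).val with h | h
  · rw [h.neg_one_pow, (Nat.Odd.sub_even hlt.le hp h).neg_one_pow]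
  · rw [h.neg_one_pow, (Nat.Odd.sub_odd hp h).neg_one_pow, neg_neg]

/-- The parity signs of the canonical representatives of the nonzero residues modulo an odd prime
sum to zero. -/
lemma ZMod.sum_units_neg_one_pow_val {p : ℕ} [Fact p.Prime] (hp : Odd p) :
    ∑ u : (ZMod p)ˣ, (-1 : ℝ) ^ (u : ZMod p).val = 0 := by
  have h := Equiv.sum_comp (Equiv.neg (ZMod p)ˣ) fun u => (-1 : ℝ) ^ (u : ZMod p).val
  simp only [Equiv.neg_apply, ZMod.neg_one_pow_val_neg_unit hp, Finset.sum_neg_distrib] at h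
  linarith

lemma ZMod.sum_neg_one_pow_val_inv_mul {p : ℕ} [Fact p.Prime] (hp : Odd p) (x : (ZMod p)ˣ) :
    ∑ a : (ZMod p)ˣ, (-1 : ℝ) ^ ((a⁻¹ * x : (ZMod p)ˣ) : ZMod p).val = 0 := by
  rw [← ZMod.sum_units_neg_one_pow_val hp]
  exact Equiv.sum_comp ((Equiv.inv (ZMod p)ˣ).trans (Equiv.mulRight x))
    fun u => (-1 : ℝ) ^ (u : ZMod p).val

/-- The gradient of a weighted square loss over a finite sample. -/
lemma hasGradientAt_const_mul_sum_half_sq_sub {ι W : Type*} [Fintype ι] [NormedAddCommGroup W]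
    [InnerProductSpace ℝ W] [CompleteSpace W] {w₀ : W} {f : W → ι → ℝ}
    (hf : ∀ x, DifferentiableAt ℝ (fun w => f w x) w₀) (c : ℝ) (y : ι → ℝ) :
    HasGradientAt (fun w => c * ∑ x, (1 / 2) * (f w x - y x) ^ 2)
      (c • ∑ x, (f w₀ x - y x) • gradient (fun w => f w x) w₀) w₀ := by
  rw [hasGradientAt_iff_hasFDerivAt]
  have h : ∀ x, HasFDerivAt (fun w => (1 / 2) * (f w x - y x) ^ 2)
      ((f w₀ x - y x) • InnerProductSpace.toDual ℝ W (gradient (fun w => f w x) w₀)) w₀ := by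
    intro x
    refine (((((hf x).hasGradientAt.hasFDerivAt).sub_const (y x)).pow 2).const_mul
      (1 / 2)).congr_fderiv ?_
    rw [← smul_assoc]
    congr 1
    simp
  simpa [map_sum] using (HasFDerivAt.fun_sum fun x (_ : x ∈ Finset.univ) => h x).const_mul c

/-- For the square-loss objectives
`L_a(w) = (1/(p-1)) · Σ_x ½·(f(w)(x) − h_a(x))²` (with
`h_a(x) = (-1)^((a⁻¹·x).val)` the parity bit of the discrete logarithm), the average
gradient `(1/(p-1)) · Σ_a ∇L_a(w₀)` equals `(1/(p-1)) · Σ_x f(w₀)(x) • g(x)`, where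
`g(x)` is the gradient of `w ↦ f(w)(x)` at `w₀`; in particular it does not depend on the
`h_a`. -/
theorem avg_gradient_indep_of_target (p : ℕ) [Fact (Nat.Prime p)] (hp : Odd p)
    (W : Type*) [NormedAddCommGroup W] [InnerProductSpace ℝ W] [CompleteSpace W]
    (w₀ : W) (f : W → (ZMod p)ˣ → ℝ)
    (hf : ∀ x : (ZMod p)ˣ, DifferentiableAt ℝ (fun w => f w x) w₀) :
    (1 / ((p : ℝ) - 1)) •
        ∑ a : (ZMod p)ˣ,
          gradient
            (fun w =>
              (1 / ((p : ℝ) - 1)) *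
                ∑ x : (ZMod p)ˣ,
                  (1 / 2) *
                    (f w x - (-1 : ℝ) ^ (((a⁻¹ * x : (ZMod p)ˣ) : ZMod p)).val) ^ 2)
            w₀ =
      (1 / ((p : ℝ) - 1)) •
        ∑ x : (ZMod p)ˣ, f w₀ x • gradient (fun w => f w x) w₀ := by
  have hcard : (Fintype.card (ZMod p)ˣ : ℝ) = (p : ℝ) - 1 := by
    rw [ZMod.card_units p, Nat.cast_pred (Fact.out : p.Prime).pos]
  have hne : (p : ℝ) - 1 ≠ 0 := by
    rw [← hcard]
    exact_mod_cast Fintype.card_ne_zero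
  simp only [fun a : (ZMod p)ˣ => (hasGradientAt_const_mul_sum_half_sq_sub hf (1 / ((p : ℝ) - 1))
    fun x => (-1 : ℝ) ^ ((a⁻¹ * x : (ZMod p)ˣ) : ZMod p).val).gradient]
  rw [← Finset.smul_sum, Finset.sum_comm]
  congr 1
  rw [Finset.smul_sum]
  refine Finset.sum_congr rfl fun x _ => ?_
  rw [← Finset.sum_smul, Finset.sum_sub_distrib, ZMod.sum_neg_one_pow_val_inv_mul hp, smul_smul,
    Finset.sum_const, Finset.card_univ, nsmul_eq_mul, hcard, sub_zero, ← mul_assoc,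
    one_div_mul_cancel hne, one_mul]
end
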